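/- arXiv:1203.4956 — 2 statements merged into one kernel-verified Lean document; each statement's English description precedes it below -/
import Mathlib

section
/- A C*-subalgebra of an n-subhomogeneous C*-algebra is n-subhomogeneous. -/
noncomputable section

/-- A (nondegenerate, topologically) irreducible representation of a `*`-algebra `A` on a
complex Hilbert space `H`: some operator in the image is nonzero, and the only closed
invariant subspaces are `⊥` and `⊤`. -/
def IsIrreducibleRep {A : Type*} [NonUnitalNonAssocSemiring A] [DistribMulAction ℂ A] [Star A]
    {H : Type*} [NormedAddCommGroup H] [InnerProductSpace ℂ H] [CompleteSpace H]
    (π : A →⋆ₙₐ[ℂ] (H →L[ℂ] H)) : Prop :=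
  (∃ a, π a ≠ 0) ∧
    ∀ S : Submodule ℂ H, IsClosed (S : Set H) →
      (∀ a : A, ∀ v ∈ S, π a v ∈ S) → S = ⊥ ∨ S = ⊤

/-- A `*`-algebra is `n`-subhomogeneous if all its irreducible representations (on complex
Hilbert spaces) have dimension at most `n`. -/
def IsSubhomogeneous (n : ℕ) (A : Type*) [NonUnitalNonAssocSemiring A]
    [DistribMulAction ℂ A] [Star A] : Prop :=
  ∀ (H : Type) [NormedAddCommGroup H] [InnerProductSpace ℂ H] [CompleteSpace H]
    (π : A →⋆ₙₐ[ℂ] (H →L[ℂ] H)), IsIrreducibleRep π → Module.rank ℂ H ≤ n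

theorem IsIrreducibleRep.exists_eq_smul_one {A : Type*} [NonUnitalNonAssocSemiring A]
    [DistribMulAction ℂ A] [Star A] {H : Type*} [NormedAddCommGroup H] [InnerProductSpace ℂ H]
    [CompleteSpace H] {π : A →⋆ₙₐ[ℂ] (H →L[ℂ] H)} (hπ : IsIrreducibleRep π) {T : H →L[ℂ] H}
    (hT : IsSelfAdjoint T) (hcomm : ∀ a, Commute T (π a)) : ∃ c : ℝ, T = c • 1 := by
  have key : (spectrum ℝ T).Subsingleton := by
    by_contra hns
    rw [Set.not_subsingleton_iff] at hns
    obtain ⟨x, hx, y, hy, hxy⟩ := hns.exists_lt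
    set m := (x + y) / 2 with hm
    have hf : cfc (fun t : ℝ ↦ max (m - t) 0) T ≠ 0 := fun h ↦ by
      have := norm_apply_le_norm_cfc (fun t : ℝ ↦ max (m - t) 0) T hx
      rw [h, norm_zero, norm_le_zero_iff, max_eq_right_iff] at this
      linarith
    have hg : cfc (fun t : ℝ ↦ max (t - m) 0) T ≠ 0 := fun h ↦ by
      have := norm_apply_le_norm_cfc (fun t : ℝ ↦ max (t - m) 0) T hy
      rw [h, norm_zero, norm_le_zero_iff, max_eq_right_iff] at this
      linarith
    have hfg : cfc (fun t : ℝ ↦ max (m - t) 0) T * cfc (fun t : ℝ ↦ max (t - m) 0) T = 0 := by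
      rw [← cfc_mul (fun t : ℝ ↦ max (m - t) 0) (fun t : ℝ ↦ max (t - m) 0) T, ← cfc_zero ℝ T]
      congr 1
      ext t
      rcases le_total m t with h | h
      · simp [max_eq_right (sub_nonpos.2 h)]
      · simp [max_eq_right (sub_nonpos.2 h)]
    rcases hπ.2 (LinearMap.ker (cfc (fun t : ℝ ↦ max (m - t) 0) T).toLinearMap)
      (ContinuousLinearMap.isClosed_ker _) (fun a v hv ↦ by
        have h := (Commute.cfc_real (hcomm a) (fun t : ℝ ↦ max (m - t) 0)).eq
        have h2 := congr($h v)
        simp only [mul_apply_eq_comp, LinearMap.mem_ker,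
          ContinuousLinearMap.coe_coe] at h2 hv ⊢
        rw [h2, hv, map_zero]) with h | h
    · refine hg (ContinuousLinearMap.ext fun v ↦ ?_)
      have : cfc (fun t : ℝ ↦ max (t - m) 0) T v ∈
          LinearMap.ker (cfc (fun t : ℝ ↦ max (m - t) 0) T).toLinearMap := by
        simpa using congr($hfg v)
      rw [h] at this
      simpa using this
    · refine hf (ContinuousLinearMap.ext fun v ↦ ?_)
      have : v ∈ LinearMap.ker (cfc (fun t : ℝ ↦ max (m - t) 0) T).toLinearMap := by
        rw [h]; trivial
      simpa using this
  obtain ⟨c, hc⟩ : ∃ c : ℝ, spectrum ℝ T ⊆ {c} := by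
    rcases Set.Subsingleton.eq_empty_or_singleton key with h | ⟨c, h⟩
    · exact ⟨0, by simp [h]⟩
    · exact ⟨c, h.le⟩
  refine ⟨c, ?_⟩
  conv_lhs => rw [← cfc_id ℝ T]
  rw [cfc_congr (f := id) (g := fun _ ↦ c) (fun t ht ↦ hc ht), cfc_const c T,
    Algebra.algebraMap_eq_smul_one]

open scoped ComplexOrder in
/-- A contractive linear functional on a unital C*-algebra with value `1` at `1` is positive. -/
theorem StrongDual.apply_nonneg_of_norm_le_one {B : Type*} [CStarAlgebra B] [PartialOrder B]
    [StarOrderedRing B] {f : StrongDual ℂ B} (hf : ‖f‖ ≤ 1) (h1 : f 1 = 1) {b : B} (hb : 0 ≤ b) :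
    0 ≤ f b := by
  have hle : ∀ x : B, ‖f x‖ ≤ ‖x‖ := fun x ↦ by
    simpa using f.le_of_opNorm_le hf x
  have him : ∀ s : ℝ, ((f b).im + s) ^ 2 ≤ ‖b‖ ^ 2 + s ^ 2 := fun s ↦ by
    have hn : ‖b + (Complex.I * s) • (1 : B)‖ ^ 2 ≤ ‖b‖ ^ 2 + s ^ 2 := by
      have e : star (b + (Complex.I * s) • (1 : B)) * (b + (Complex.I * s) • (1 : B)) =
          b * b + ((s : ℂ) ^ 2) • (1 : B) := by
        have hI : (Complex.I * s) * (Complex.I * s) = -(s : ℂ) ^ 2 := by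
          linear_combination (s : ℂ) ^ 2 * Complex.I_mul_I
        simp only [star_add, star_smul, star_one, hb.isSelfAdjoint.star_eq, Complex.star_def,
          map_mul, Complex.conj_I, Complex.conj_ofReal, mul_add, add_mul, smul_mul_assoc,
          mul_smul_comm, one_mul, mul_one, smul_add, smul_smul, neg_mul, neg_smul, smul_neg, hI]
        abel
      rw [sq, ← CStarRing.norm_star_mul_self, e]
      refine (norm_add_le _ _).trans (add_le_add ?_ ?_)
      · rw [sq]; exact norm_mul_le _ _
      · rcases subsingleton_or_nontrivial B with h | h
        · rw [Subsingleton.elim (((s : ℂ) ^ 2) • (1 : B)) 0, norm_zero]; positivity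
        · simp [norm_smul]
    have h := (hle (b + (Complex.I * s) • (1 : B)))
    have h2 := Complex.abs_im_le_norm (f (b + (Complex.I * s) • (1 : B)))
    have h3 : (f (b + (Complex.I * s) • (1 : B))).im = (f b).im + s := by
      simp [h1]
    rw [h3] at h2
    rw [← sq_abs]
    exact (pow_le_pow_left₀ (abs_nonneg _) (h2.trans h) 2).trans hn
  have him0 : (f b).im = 0 := by
    by_contra hne
    have := him ((‖b‖ ^ 2 + 1) / (2 * (f b).im))
    have e : 2 * (f b).im * ((‖b‖ ^ 2 + 1) / (2 * (f b).im)) = ‖b‖ ^ 2 + 1 := by field_simp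
    nlinarith [sq_nonneg (f b).im]
  have hre : 0 ≤ (f b).re := by
    have hn : ‖algebraMap ℝ B ‖b‖ - b‖ ≤ ‖b‖ := by
      have hbs : IsSelfAdjoint b := hb.isSelfAdjoint
      have : b ≤ algebraMap ℝ B ‖b‖ := hbs.le_algebraMap_norm_self
      rw [CStarAlgebra.norm_le_iff_le_algebraMap _ (norm_nonneg _) (sub_nonneg.2 this)]
      exact sub_le_self _ hb
    have h := (Complex.abs_re_le_norm _).trans ((hle _).trans hn)
    have e : f (algebraMap ℝ B ‖b‖) = (‖b‖ : ℂ) := by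
      rw [Algebra.algebraMap_eq_smul_one, ← Complex.coe_smul, map_smul, h1, smul_eq_mul, mul_one]
    rw [map_sub, e, Complex.sub_re, Complex.ofReal_re, abs_le] at h
    linarith [h.2]
  exact Complex.nonneg_iff.2 ⟨hre, him0.symm⟩

open scoped InnerProductSpace ComplexOrder CStarAlgebra in
/-- The Gelfand–Naimark–Segal representation of a contractive functional taking the value `1`
at `1`. -/
theorem StrongDual.exists_cyclic_rep.{u} {B : Type u} [CStarAlgebra B]
    {f : StrongDual ℂ B} (hf : ‖f‖ ≤ 1) (h1 : f 1 = 1) :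
    ∃ (K : Type u) (_ : NormedAddCommGroup K) (_ : InnerProductSpace ℂ K) (_ : CompleteSpace K)
      (ρ : B →⋆ₐ[ℂ] (K →L[ℂ] K)) (ξ : K), DenseRange (fun b ↦ ρ b ξ) ∧
      ∀ b, ⟪ξ, ρ b ξ⟫_ℂ = f b := by
  let _ := CStarAlgebra.spectralOrder B
  have := CStarAlgebra.spectralOrderedRing B
  obtain ⟨g, hg⟩ : ∃ g : B →ₚ[ℂ] ℂ, ∀ b, g b = f b :=
    ⟨PositiveLinearMap.mk₀ f.toLinearMap
      fun b hb ↦ StrongDual.apply_nonneg_of_norm_le_one hf h1 hb, fun _ ↦ rfl⟩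
  have hρ : ∀ b, g.gnsStarAlgHom b (g.toPreGNS 1 : g.GNS) = (g.toPreGNS b : g.GNS) := fun b ↦ by
    simp
  refine ⟨g.GNS, inferInstance, inferInstance, inferInstance, g.gnsStarAlgHom,
    (g.toPreGNS 1 : g.GNS), ?_, fun b ↦ ?_⟩
  · simp_rw [hρ]
    exact UniformSpace.Completion.denseRange_coe.comp g.toPreGNS.surjective.denseRange
      (UniformSpace.Completion.continuous_coe _)
  · rw [hρ, UniformSpace.Completion.inner_coe, PositiveLinearMap.preGNS_inner_def]
    simp [hg]

open scoped InnerProductSpace in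
/-- Two `*`-representations of a `*`-algebra with vectors giving the same vector functional are
intertwined by an isometry if the first vector is cyclic. -/
theorem exists_intertwining_isometry {A : Type*} [Ring A] [StarRing A] [Algebra ℂ A]
    {H K : Type*} [NormedAddCommGroup H] [InnerProductSpace ℂ H] [CompleteSpace H]
    [NormedAddCommGroup K] [InnerProductSpace ℂ K] [CompleteSpace K]
    (π : A →⋆ₐ[ℂ] (H →L[ℂ] H)) (σ : A →⋆ₐ[ℂ] (K →L[ℂ] K)) {η : H} {ξ : K}
    (hη : DenseRange (fun a ↦ π a η)) (h : ∀ a, ⟪ξ, σ a ξ⟫_ℂ = ⟪η, π a η⟫_ℂ) :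
    ∃ V : H →L[ℂ] K, (∀ v, ‖V v‖ = ‖v‖) ∧ V η = ξ ∧ ∀ a v, V (π a v) = σ a (V v) := by
  obtain ⟨e, he⟩ : ∃ e : A →ₗ[ℂ] H, ∀ a, e a = π a η :=
    ⟨LinearMap.applyₗ η ∘ₗ ContinuousLinearMap.coeLM ℂ ∘ₗ π.toLinearMap, fun _ ↦ rfl⟩
  obtain ⟨g, hg⟩ : ∃ g : A →ₗ[ℂ] K, ∀ a, g a = σ a ξ :=
    ⟨LinearMap.applyₗ ξ ∘ₗ ContinuousLinearMap.coeLM ℂ ∘ₗ σ.toLinearMap, fun _ ↦ rfl⟩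
  have hden : DenseRange e := by simpa only [← he] using hη
  have hnorm : ∀ a, ‖g a‖ = ‖e a‖ := fun a ↦ by
    have h' := h (star a * a)
    simp only [map_mul, map_star, mul_apply_eq_comp, ContinuousLinearMap.star_eq_adjoint,
      ContinuousLinearMap.adjoint_inner_right, inner_self_eq_norm_sq_to_K] at h'
    rw [he, hg, ← sq_eq_sq₀ (norm_nonneg _) (norm_nonneg _)]
    exact_mod_cast h'
  have hV : ∀ a, g.extendOfNorm e (π a η) = σ a ξ :=
    fun a ↦ by
      rw [← he, ← hg]
      exact LinearMap.extendOfNorm_eq hden ⟨1, fun a ↦ by rw [hnorm, one_mul]⟩ a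
  refine ⟨g.extendOfNorm e, fun v ↦ ?_, ?_, fun a v ↦ ?_⟩
  · refine hη.induction_on v (isClosed_eq (by fun_prop) (by fun_prop)) fun a ↦ ?_
    rw [hV, ← he, ← hg, hnorm]
  · simpa using hV 1
  · refine hη.induction_on v (isClosed_eq (by fun_prop) (by fun_prop)) fun b ↦ ?_
    have h2 := hV (a * b)
    rw [map_mul, map_mul, mul_apply_eq_comp, mul_apply_eq_comp] at h2
    rw [h2, hV]

/-- Every nonzero vector of an irreducible representation is cyclic. -/
theorem IsIrreducibleRep.denseRange_apply {A : Type*} [Ring A] [StarRing A] [Algebra ℂ A]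
    {H : Type*} [NormedAddCommGroup H] [InnerProductSpace ℂ H] [CompleteSpace H]
    {π : A →⋆ₐ[ℂ] (H →L[ℂ] H)} (hπ : IsIrreducibleRep π.toNonUnitalStarAlgHom) {η : H}
    (hη : η ≠ 0) : DenseRange (fun a ↦ π a η) := by
  let e : A →ₗ[ℂ] H := LinearMap.applyₗ η ∘ₗ ContinuousLinearMap.coeLM ℂ ∘ₗ π.toLinearMap
  have he : ∀ a, e a = π a η := fun a ↦ rfl
  rcases hπ.2 (LinearMap.range e).topologicalClosure
    (Submodule.isClosed_topologicalClosure _) (fun a v hv ↦ by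
      refine map_mem_closure (π a).continuous hv ?_
      rintro _ ⟨b, rfl⟩
      exact ⟨a * b, by simp [he]⟩) with h | h
  · have : η ∈ (LinearMap.range e).topologicalClosure :=
      Submodule.le_topologicalClosure _ ⟨1, by simp [he]⟩
    rw [h] at this
    exact absurd (by simpa using this) hη
  · exact (Submodule.dense_iff_topologicalClosure_eq_top).2 h
/-- The contractive extensions of a functional `φ` along a map `θ : A → B`. -/
def contractiveExtensions {A B : Type*} [NormedRing B] [NormedAlgebra ℂ B] (θ : A → B)
    (φ : A → ℂ) : Set (WeakDual ℂ B) :=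
  {f | ‖WeakDual.toStrongDual f‖ ≤ 1 ∧ ∀ a, f (θ a) = φ a}

theorem isCompact_contractiveExtensions {A B : Type*} [NormedRing B] [NormedAlgebra ℂ B]
    (θ : A → B) (φ : A → ℂ) : IsCompact (contractiveExtensions θ φ) := by
  have h : contractiveExtensions θ φ =
      (WeakDual.toStrongDual ⁻¹' Metric.closedBall 0 1) ∩
        ⋂ a, {f : WeakDual ℂ B | f (θ a) = φ a} := by
    ext f
    simp [contractiveExtensions]
  rw [h]
  exact (WeakDual.isCompact_closedBall 0 1).inter_right
    (isClosed_iInter fun a ↦ isClosed_eq (WeakDual.eval_continuous _) continuous_const)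

theorem contractiveExtensions_nonempty {A B : Type*} [CStarAlgebra A] [CStarAlgebra B]
    {θ : A →⋆ₐ[ℂ] B} (hθ : Function.Injective θ) {φ : StrongDual ℂ A} (hφ : ‖φ‖ ≤ 1) :
    (contractiveExtensions θ φ).Nonempty := by
  let e : A ≃ₗ[ℂ] LinearMap.range θ.toLinearMap := LinearEquiv.ofInjective θ.toLinearMap hθ
  have he : ∀ x, ‖e.symm x‖ = ‖x‖ := fun x ↦ by
    obtain ⟨a, rfl⟩ := e.surjective x
    rw [e.symm_apply_apply]
    exact (NonUnitalStarAlgHom.norm_map θ hθ a).symm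
  obtain ⟨g, hg, hgn⟩ := exists_extension_norm_eq (𝕜 := ℂ) (LinearMap.range θ.toLinearMap)
    ((φ.toLinearMap ∘ₗ e.symm.toLinearMap).mkContinuous 1 fun x ↦ by
      rw [← he]
      exact φ.le_of_opNorm_le hφ _)
  refine ⟨StrongDual.toWeakDual g, ?_, fun a ↦ ?_⟩
  · change ‖g‖ ≤ 1
    rw [hgn]
    exact LinearMap.mkContinuous_norm_le _ zero_le_one _
  · have := hg (e a)
    simp only [LinearMap.mkContinuous_apply, LinearMap.comp_apply, LinearEquiv.coe_coe,
      e.symm_apply_apply] at this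
    exact this

open scoped InnerProductSpace in
/-- Compressing the vector state of `ξ` by a projection in the commutant of `ρ` and normalizing
yields another contractive extension of the vector functional of `η`. -/
theorem exists_contractiveExtension_of_isStarProjection {A B : Type*} [CStarAlgebra A]
    [CStarAlgebra B] (θ : A →⋆ₐ[ℂ] B)
    {H K : Type*} [NormedAddCommGroup H] [InnerProductSpace ℂ H] [CompleteSpace H]
    [NormedAddCommGroup K] [InnerProductSpace ℂ K] [CompleteSpace K]
    {π : A →⋆ₐ[ℂ] (H →L[ℂ] H)} (hπ : IsIrreducibleRep π.toNonUnitalStarAlgHom)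
    {ρ : B →⋆ₐ[ℂ] (K →L[ℂ] K)} {η : H} {ξ : K} (hη : ‖η‖ = 1) {V : H →L[ℂ] K}
    (hVη : V η = ξ) (hV : ∀ a v, V (π a v) = ρ (θ a) (V v))
    {Q : K →L[ℂ] K} (hQ : IsStarProjection Q) (hcomm : ∀ b, Commute Q (ρ b)) (hQξ : Q ξ ≠ 0) :
    ∃ g ∈ contractiveExtensions θ (fun a ↦ ⟪η, π a η⟫_ℂ),
      ∀ b, ⟪Q ξ, ρ b ξ⟫_ℂ = (‖Q ξ‖ ^ 2 : ℝ) * g b := by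
  have hQadj : ∀ x y, ⟪Q x, y⟫_ℂ = ⟪x, Q y⟫_ℂ := fun x y ↦ by
    rw [← ContinuousLinearMap.adjoint_inner_right, ← ContinuousLinearMap.star_eq_adjoint,
      hQ.isSelfAdjoint.star_eq]
  have hQQ : ∀ x, Q (Q x) = Q x := fun x ↦ congr($(hQ.isIdempotentElem.eq) x)
  have hQρ : ∀ b x, Q (ρ b x) = ρ b (Q x) := fun b x ↦ congr($((hcomm b).eq) x)
  have hVadj : ∀ a x, V.adjoint (ρ (θ a) x) = π a (V.adjoint x) := fun a x ↦ by
    refine ext_inner_right ℂ fun v ↦ ?_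
    have h1 : ∀ x y, ⟪π a x, y⟫_ℂ = ⟪x, π (star a) y⟫_ℂ := fun x y ↦ by
      rw [map_star, ContinuousLinearMap.star_eq_adjoint, ContinuousLinearMap.adjoint_inner_right]
    have h2 : ∀ x y, ⟪ρ (θ a) x, y⟫_ℂ = ⟪x, ρ (θ (star a)) y⟫_ℂ := fun x y ↦ by
      rw [map_star, map_star, ContinuousLinearMap.star_eq_adjoint,
        ContinuousLinearMap.adjoint_inner_right]
    rw [ContinuousLinearMap.adjoint_inner_left, h1, h2, ContinuousLinearMap.adjoint_inner_left, hV]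
  obtain ⟨c, hc⟩ := hπ.exists_eq_smul_one (T := V.adjoint ∘L Q ∘L V)
    (by
      have : IsSelfAdjoint (V.adjoint ∘L Q ∘L V) := hQ.isSelfAdjoint.adjoint_conj V
      exact this)
    (fun a ↦ by
      ext v
      change V.adjoint (Q (V (π a v))) = π a (V.adjoint (Q (V v)))
      rw [hV, hQρ, hVadj])
  have hcv : ∀ v, ⟪Q ξ, V v⟫_ℂ = c * ⟪η, v⟫_ℂ := fun v ↦ by
    have := congr(⟪η, $hc v⟫_ℂ)
    simp only [ContinuousLinearMap.comp_apply, ContinuousLinearMap.adjoint_inner_right,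
      smul_apply, one_apply_eq_self, ← Complex.coe_smul,
      inner_smul_right] at this
    rw [hQadj, ← hVη, this]
  have hcn : (‖Q ξ‖ ^ 2 : ℝ) = c := by
    have h1 := hcv η
    rw [hVη, ← hQQ, hQadj, inner_self_eq_norm_sq_to_K, inner_self_eq_norm_sq_to_K, hη] at h1
    have h2 : ((‖Q ξ‖ ^ 2 : ℝ) : ℂ) = (c : ℂ) := by simpa using h1
    exact_mod_cast h2
  have hpos : 0 < ‖Q ξ‖ ^ 2 := by positivity
  obtain ⟨L, hL⟩ : ∃ L : B →ₗ[ℂ] ℂ, ∀ b, L b = ⟪Q ξ, ρ b ξ⟫_ℂ :=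
    ⟨(innerSL ℂ (Q ξ)).toLinearMap ∘ₗ LinearMap.applyₗ ξ ∘ₗ ContinuousLinearMap.coeLM ℂ ∘ₗ
      ρ.toLinearMap, fun _ ↦ rfl⟩
  have hbound : ∀ b, ‖(((‖Q ξ‖ ^ 2 : ℝ) : ℂ)⁻¹ • L) b‖ ≤ 1 * ‖b‖ := fun b ↦ by
    have hb : ‖L b‖ ≤ ‖Q ξ‖ ^ 2 * ‖b‖ := by
      rw [hL, ← hQQ ξ, hQadj, hQρ, hQQ]
      calc ‖⟪Q ξ, ρ b (Q ξ)⟫_ℂ‖ ≤ ‖Q ξ‖ * (‖b‖ * ‖Q ξ‖) :=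
            (norm_inner_le_norm _ _).trans (mul_le_mul_of_nonneg_left
              ((ρ b).le_of_opNorm_le (NonUnitalStarAlgHom.norm_apply_le ρ b) _) (norm_nonneg _))
        _ = ‖Q ξ‖ ^ 2 * ‖b‖ := by ring
    rw [LinearMap.smul_apply, norm_smul, norm_inv, Complex.norm_of_nonneg hpos.le, one_mul,
      inv_mul_le_iff₀ hpos]
    exact hb
  refine ⟨StrongDual.toWeakDual (LinearMap.mkContinuous _ 1 hbound), ⟨?_, fun a ↦ ?_⟩, fun b ↦ ?_⟩
  · exact LinearMap.mkContinuous_norm_le _ zero_le_one hbound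
  · change ((‖Q ξ‖ ^ 2 : ℝ) : ℂ)⁻¹ * L (θ a) = _
    rw [hL, ← hVη, ← hV, hVη, hcv, ← hcn, inv_mul_cancel_left₀ (by exact_mod_cast hpos.ne')]
  · change _ = _ * (((‖Q ξ‖ ^ 2 : ℝ) : ℂ)⁻¹ * L b)
    rw [hL, mul_inv_cancel_left₀ (by exact_mod_cast hpos.ne')]

open scoped InnerProductSpace in
/-- The cyclic representation of an extreme extension of a vector functional of an irreducible
representation is irreducible. -/
theorem isIrreducibleRep_of_mem_extremePoints {A B : Type*} [CStarAlgebra A]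
    [CStarAlgebra B] (θ : A →⋆ₐ[ℂ] B)
    {H K : Type*} [NormedAddCommGroup H] [InnerProductSpace ℂ H] [CompleteSpace H]
    [NormedAddCommGroup K] [InnerProductSpace ℂ K] [CompleteSpace K]
    {π : A →⋆ₐ[ℂ] (H →L[ℂ] H)} (hπ : IsIrreducibleRep π.toNonUnitalStarAlgHom)
    {ρ : B →⋆ₐ[ℂ] (K →L[ℂ] K)} {η : H} {ξ : K} (hη : ‖η‖ = 1) {V : H →L[ℂ] K}
    (hVη : V η = ξ) (hV : ∀ a v, V (π a v) = ρ (θ a) (V v)) {f : WeakDual ℂ B}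
    (hf : f ∈ (contractiveExtensions θ (fun a ↦ ⟪η, π a η⟫_ℂ)).extremePoints ℝ)
    (hfξ : ∀ b, ⟪ξ, ρ b ξ⟫_ℂ = f b) (hξ : DenseRange fun b ↦ ρ b ξ) :
    IsIrreducibleRep ρ.toNonUnitalStarAlgHom := by
  have hone : ∀ g ∈ contractiveExtensions θ (fun a ↦ ⟪η, π a η⟫_ℂ), g 1 = 1 := fun g hg ↦ by
    have h : g (θ 1) = ⟪η, π 1 η⟫_ℂ := hg.2 1
    rw [map_one θ, map_one π, one_apply_eq_self, inner_self_eq_norm_sq_to_K, hη] at h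
    simpa using h
  have hξξ : ⟪ξ, ξ⟫_ℂ = 1 := by
    rw [← hone f hf.1, ← hfξ, map_one, one_apply_eq_self]
  have hzero : ∀ Q : K →L[ℂ] K, (∀ b, Commute Q (ρ b)) → Q ξ = 0 → Q = 0 := fun Q hQ h ↦ by
    ext v
    refine hξ.induction_on v (isClosed_eq (by fun_prop) (by fun_prop)) fun b ↦ ?_
    have := congr($((hQ b).eq) ξ)
    rw [mul_apply_eq_comp, mul_apply_eq_comp, h, map_zero] at this
    simpa using this
  refine ⟨⟨1, fun h ↦ ?_⟩, fun S hS hinv ↦ ?_⟩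
  · have : ρ 1 ξ = 0 := congr($h ξ)
    rw [map_one, one_apply_eq_self] at this
    simp [this] at hξξ
  have : CompleteSpace S := hS.completeSpace_coe
  have hinv' : ∀ b, ∀ v ∈ S, ρ b v ∈ S := hinv
  set P := S.starProjection with hPdef
  have hP : IsStarProjection P := isStarProjection_starProjection
  have hPcomm : ∀ b, Commute P (ρ b) := fun b ↦ by
    ext v
    rw [mul_apply_eq_comp, mul_apply_eq_comp]
    refine (Submodule.eq_starProjection_of_mem_of_inner_eq_zero
      (hinv' b _ (S.starProjection_apply_mem v)) fun w hw ↦ ?_)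
    have h1 : ∀ x y, ⟪ρ b x, y⟫_ℂ = ⟪x, ρ (star b) y⟫_ℂ := fun x y ↦ by
      rw [map_star, ContinuousLinearMap.star_eq_adjoint, ContinuousLinearMap.adjoint_inner_right]
    rw [← map_sub, h1]
    exact Submodule.starProjection_inner_eq_zero v _ (hinv' _ w hw)
  have hP' : IsStarProjection (1 - P) := hP.one_sub
  have hPcomm' : ∀ b, Commute (1 - P) (ρ b) := fun b ↦ (Commute.one_left _).sub_left (hPcomm b)
  by_cases h0 : P ξ = 0
  · left
    have := hzero P hPcomm h0
    rw [hPdef] at this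
    refine (Submodule.eq_bot_iff _).2 fun x hx ↦ ?_
    rw [← Submodule.starProjection_eq_self_iff.2 hx, this, zero_apply]
  by_cases h1 : (1 - P) ξ = 0
  · right
    have := hzero _ hPcomm' h1
    refine Submodule.eq_top_iff'.2 fun x ↦ ?_
    rw [← Submodule.starProjection_eq_self_iff, ← hPdef, ← sub_eq_zero.1 this,
      one_apply_eq_self]
  exfalso
  obtain ⟨g, hg, hgP⟩ :=
    exists_contractiveExtension_of_isStarProjection θ hπ hη hVη hV hP hPcomm h0
  obtain ⟨g', hg', hgP'⟩ :=
    exists_contractiveExtension_of_isStarProjection θ hπ hη hVη hV hP' hPcomm' h1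
  have hPPξ : P (P ξ) = P ξ := congr($(hP.isIdempotentElem.eq) ξ)
  have hsum : ‖P ξ‖ ^ 2 + ‖(1 - P) ξ‖ ^ 2 = 1 := by
    have h := congr($(hgP 1) + $(hgP' 1))
    rw [← inner_add_left, hone g hg, hone g' hg', mul_one, mul_one, map_one, one_apply_eq_self,
      sub_apply, one_apply_eq_self, add_sub_cancel, hξξ] at h
    exact_mod_cast h.symm
  have hseg : f ∈ openSegment ℝ g g' := by
    refine ⟨‖P ξ‖ ^ 2, ‖(1 - P) ξ‖ ^ 2, by positivity, by positivity, hsum, ?_⟩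
    refine DFunLike.ext _ _ fun b ↦ ?_
    rw [← hfξ]
    change (‖P ξ‖ ^ 2 : ℝ) • g b + (‖(1 - P) ξ‖ ^ 2 : ℝ) • g' b = _
    rw [Complex.real_smul, Complex.real_smul, ← hgP, ← hgP', ← inner_add_left]
    simp
  obtain rfl : g = f := ((mem_extremePoints.1 hf).2 g hg g' hg' hseg).1
  have hPξ : P ξ = ((‖P ξ‖ ^ 2 : ℝ) : ℂ) • ξ := by
    refine hξ.eq_of_inner_left ℂ fun b ↦ ?_
    rw [hgP, inner_smul_left, hfξ, Complex.conj_ofReal]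
  have ht : ((‖P ξ‖ ^ 2 : ℝ) : ℂ) = 1 := by
    have h := congr(P $hPξ)
    rw [hPPξ, map_smul] at h
    refine smul_left_injective ℂ h0 ?_
    simpa using h.symm
  have ht' : ‖P ξ‖ ^ 2 = 1 := by exact_mod_cast ht
  have : 0 < ‖(1 - P) ξ‖ ^ 2 := by positivity
  linarith

open scoped InnerProductSpace in
/-- Every irreducible representation of a unital C*-subalgebra embeds into an irreducible
representation of the C*-algebra. -/
theorem exists_irreducibleRep_extension.{u} {A : Type*} {B : Type u} [CStarAlgebra A]
    [CStarAlgebra B] {θ : A →⋆ₐ[ℂ] B} (hθ : Function.Injective θ)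
    {H : Type*} [NormedAddCommGroup H] [InnerProductSpace ℂ H] [CompleteSpace H]
    {π : A →⋆ₐ[ℂ] (H →L[ℂ] H)} (hπ : IsIrreducibleRep π.toNonUnitalStarAlgHom) :
    ∃ (K : Type u) (_ : NormedAddCommGroup K) (_ : InnerProductSpace ℂ K) (_ : CompleteSpace K)
      (ρ : B →⋆ₐ[ℂ] (K →L[ℂ] K)) (V : H →L[ℂ] K),
      IsIrreducibleRep ρ.toNonUnitalStarAlgHom ∧ (∀ v, ‖V v‖ = ‖v‖) ∧
      ∀ a v, V (π a v) = ρ (θ a) (V v) := by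
  have : Nontrivial H := by
    by_contra h
    rw [not_nontrivial_iff_subsingleton] at h
    obtain ⟨a, ha⟩ := hπ.1
    exact ha (Subsingleton.elim _ _)
  obtain ⟨η, hη⟩ := exists_norm_eq H zero_le_one
  obtain ⟨L, hL⟩ : ∃ L : A →ₗ[ℂ] ℂ, ∀ a, L a = ⟪η, π a η⟫_ℂ :=
    ⟨(innerSL ℂ η).toLinearMap ∘ₗ LinearMap.applyₗ η ∘ₗ ContinuousLinearMap.coeLM ℂ ∘ₗ
      π.toLinearMap, fun _ ↦ rfl⟩
  have hbound : ∀ a, ‖L a‖ ≤ 1 * ‖a‖ := fun a ↦ by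
    rw [hL]
    refine (norm_inner_le_norm _ _).trans ?_
    have := (π a).le_of_opNorm_le (NonUnitalStarAlgHom.norm_apply_le π a) η
    rwa [hη, one_mul, one_mul, ← mul_one ‖a‖, ← hη]
  have hne := contractiveExtensions_nonempty hθ (φ := L.mkContinuous 1 hbound)
    (LinearMap.mkContinuous_norm_le _ zero_le_one _)
  have hφ : ⇑(L.mkContinuous 1 hbound) = fun a ↦ ⟪η, π a η⟫_ℂ := funext hL
  rw [hφ] at hne
  have : LocallyConvexSpace ℝ (WeakDual ℂ B) :=
    inferInstanceAs (LocallyConvexSpace ℝ (WeakBilin (topDualPairing ℂ B)))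
  obtain ⟨f, hf⟩ := (isCompact_contractiveExtensions θ fun a ↦ ⟪η, π a η⟫_ℂ).extremePoints_nonempty
    hne
  have hf1 : f 1 = 1 := by
    have h : f (θ 1) = ⟪η, π 1 η⟫_ℂ := hf.1.2 1
    rw [map_one θ, map_one π, one_apply_eq_self, inner_self_eq_norm_sq_to_K, hη] at h
    simpa using h
  obtain ⟨K, _, _, _, ρ, ξ, hξ, hfξ⟩ :=
    StrongDual.exists_cyclic_rep (f := WeakDual.toStrongDual f) hf.1.1 hf1
  have hη0 : η ≠ 0 := fun h ↦ by simp [h] at hη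
  obtain ⟨V, hVn, hVη, hV⟩ := exists_intertwining_isometry π (ρ.comp θ) (ξ := ξ)
    (hπ.denseRange_apply hη0) fun a ↦ (hfξ (θ a)).trans (hf.1.2 a)
  exact ⟨K, inferInstance, inferInstance, inferInstance, ρ, V,
    isIrreducibleRep_of_mem_extremePoints θ hπ hη hVη hV hf hfξ hξ, hVn, hV⟩

/-- The unitization of an `n`-subhomogeneous algebra is `n`-subhomogeneous if `1 ≤ n`. -/
theorem IsSubhomogeneous.unitization {n : ℕ} (hn : 1 ≤ n) {B : Type*} [NonUnitalCStarAlgebra B]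
    (hB : IsSubhomogeneous n B) {K : Type} [NormedAddCommGroup K] [InnerProductSpace ℂ K]
    [CompleteSpace K] {ρ : Unitization ℂ B →⋆ₐ[ℂ] (K →L[ℂ] K)}
    (hρ : IsIrreducibleRep ρ.toNonUnitalStarAlgHom) : Module.rank ℂ K ≤ n := by
  have hρx : ∀ (x : Unitization ℂ B) (v : K), ρ x v = x.fst • v + ρ (x.snd : Unitization ℂ B) v := by
    intro x v
    conv_lhs => rw [← Unitization.inl_fst_add_inr_snd_eq x]
    rw [map_add, add_apply, ← Unitization.algebraMap_eq_inl, AlgHomClass.commutes,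
      Algebra.algebraMap_eq_smul_one, smul_apply, one_apply_eq_self]
  by_cases h : ∃ b : B, ρ (b : Unitization ℂ B) ≠ 0
  · refine hB K (Unitization.starLift.symm ρ) ⟨h, fun S hS hinv ↦ hρ.2 S hS fun x v hv ↦ ?_⟩
    change ρ x v ∈ S
    rw [hρx]
    exact S.add_mem (S.smul_mem _ hv) (hinv x.snd v hv)
  · push Not at h
    have hS : ∀ S : Submodule ℂ K, IsClosed (S : Set K) → S = ⊥ ∨ S = ⊤ := fun S hS ↦
      hρ.2 S hS fun x v hv ↦ by
        change ρ x v ∈ S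
        rw [hρx, h]
        simpa using S.smul_mem _ hv
    have h1 : Module.rank ℂ K ≤ 1 := by
      rcases subsingleton_or_nontrivial K with _ | _
      · simp
      obtain ⟨v, hv⟩ := exists_ne (0 : K)
      rcases hS (ℂ ∙ v) (Submodule.closed_of_finiteDimensional _) with h | h
      · exact absurd (Submodule.span_singleton_eq_bot.1 h) hv
      · rw [← rank_top, ← h]
        exact (rank_span_le _).trans (by simp)
    exact h1.trans (by exact_mod_cast hn)

/-- A C*-subalgebra of an `n`-subhomogeneous C*-algebra is
`n`-subhomogeneous.  (A C*-subalgebra of `B` is presented as a C*-algebra `A` together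
with an injective `*`-homomorphism `A → B`.) -/
theorem stmt4 (n : ℕ) (hn : 1 ≤ n) (A B : Type) [NonUnitalCStarAlgebra A]
    [NonUnitalCStarAlgebra B] (θ : A →⋆ₙₐ[ℂ] B) (hθ : Function.Injective θ)
    (hB : IsSubhomogeneous n B) : IsSubhomogeneous n A := by
  intro H _ _ _ π hπ
  have hlift : ∀ a : A, Unitization.starLift π (a : Unitization ℂ A) = π a := fun a ↦
    congr($(Unitization.starLift.symm_apply_apply π) a)
  have hπ' : IsIrreducibleRep (Unitization.starLift π).toNonUnitalStarAlgHom := by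
    refine ⟨?_, fun S hS hinv ↦ hπ.2 S hS fun a v hv ↦ ?_⟩
    · obtain ⟨a, ha⟩ := hπ.1
      exact ⟨(a : Unitization ℂ A), fun h ↦ ha ((hlift a).symm.trans h)⟩
    · rw [← hlift]
      exact hinv (a : Unitization ℂ A) v hv
  obtain ⟨K, _, _, _, ρ, V, hρ, hV, -⟩ :=
    exists_irreducibleRep_extension (Unitization.starMap_injective hθ) hπ'
  refine le_trans (LinearMap.rank_le_of_injective V.toLinearMap ?_) (hB.unitization hn hρ)
  exact (AddMonoidHomClass.isometry_of_norm V hV).injective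

end
end

section
/- A C*-algebra A is n-subhomogeneous if and only if its bidual A** (the enveloping von Neumann algebra) is n-subhomogeneous as a C*-algebra. -/
noncomputable section

open scoped ComplexOrder InnerProductSpace

/-- The orthogonal projection onto a subspace invariant under `T` and `T†` commutes with `T`. -/
theorem Submodule.starProjection_commute_of_invariant {H : Type*} [NormedAddCommGroup H]
    [InnerProductSpace ℂ H] [CompleteSpace H] (S : Submodule ℂ H) [S.HasOrthogonalProjection]
    (T : H →L[ℂ] H) (hT : ∀ v ∈ S, T v ∈ S) (hT' : ∀ v ∈ S, star T v ∈ S) :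
    S.starProjection * T = T * S.starProjection := by
  ext v
  refine Submodule.eq_starProjection_of_mem_orthogonal (hT _ (S.starProjection_apply_mem v)) ?_
  change T v - T (S.starProjection v) ∈ Sᗮ
  intro w hw
  rw [← map_sub, ← ContinuousLinearMap.adjoint_inner_left]
  exact (S.sub_starProjection_mem_orthogonal v) _ (hT' w hw)

section States

variable {B : Type*} [CStarAlgebra B]

/-- The state space of a unital C*-algebra, as a subset of the weak dual. -/
def stateSpace (B : Type*) [CStarAlgebra B] : Set (WeakDual ℂ B) :=
  {f | (∀ a, 0 ≤ f (star a * a)) ∧ f 1 = 1}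

theorem exists_mem_stateSpace_apply_ne_zero {a : B} (ha : a ≠ 0) :
    ∃ f ∈ stateSpace B, f (star a * a) ≠ 0 := by
  let _ := CStarAlgebra.spectralOrder B
  have := CStarAlgebra.spectralOrderedRing B
  have hb : -(star a * a) ∉ ProperCone.positive ℝ B := by
    intro h
    have h1 : 0 ≤ -(star a * a) := h
    have h2 := star_mul_self_nonneg a
    have h3 : star a * a = 0 := le_antisymm (neg_nonneg.mp h1) h2
    exact ha (CStarRing.star_mul_self_eq_zero_iff a |>.mp h3)
  obtain ⟨g, hg, hgb⟩ := ProperCone.hyperplane_separation_point _ hb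
  replace hg : ∀ x : B, 0 ≤ g (star x * x) := fun x => hg _ (star_mul_self_nonneg x)
  let h : B →L[ℝ] ℝ := (2⁻¹ : ℝ) • (g + g ∘L (starL' ℝ : B ≃L[ℝ] B).toContinuousLinearMap)
  have hh (x : B) : h x = 2⁻¹ * (g x + g (star x)) := by
    simp [h, mul_add]
  let F : B →L[ℂ] ℂ := StrongDual.extendRCLike (𝕜 := ℂ) h
  have hF (x : B) : F (star x * x) = (g (star x * x) : ℂ) := by
    have h1 : h (star x * x) = g (star x * x) := by
      rw [hh]; simp; ring
    have h2 : h (Complex.I • (star x * x)) = 0 := by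
      rw [hh]; simp
    have := StrongDual.extendRCLike_apply (𝕜 := ℂ) h (star x * x)
    simp only [RCLike.I_to_complex] at this
    simp only [F, this, h1, h2]; simp
  have hpos (x : B) : 0 ≤ F (star x * x) := by
    rw [hF]; exact_mod_cast hg x
  have hFa : 0 < g (star a * a) := by simpa using hgb
  have hF1 : F 1 = (g 1 : ℂ) := by simpa using hF 1
  have hg1 : 0 < g 1 := by
    have h0 : 0 ≤ g 1 := by simpa using hg 1
    refine lt_of_le_of_ne h0 fun h0 => ?_
    let φ : B →ₚ[ℂ] ℂ := PositiveLinearMap.mk₀ (F : B →ₗ[ℂ] ℂ) (fun x hx => by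
      obtain ⟨y, rfl⟩ := CStarAlgebra.nonneg_iff_eq_star_mul_self.mp hx
      exact hpos y)
    have := φ.norm_apply_le_of_nonneg (star a * a) (star_mul_self_nonneg a)
    have e1 : φ 1 = 0 := by
      change F 1 = 0
      rw [hF1, ← h0]; simp
    have e2 : φ (star a * a) = (g (star a * a) : ℂ) := hF a
    rw [e1, e2] at this
    simp at this
    linarith
  refine ⟨((g 1)⁻¹ : ℂ) • F, ⟨fun x => ?_, ?_⟩, ?_⟩
  · change 0 ≤ ((g 1)⁻¹ : ℂ) * F (star x * x)
    have : (0 : ℂ) ≤ (g 1 : ℂ)⁻¹ := by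
      rw [← Complex.ofReal_inv]; exact_mod_cast (inv_pos.mpr hg1).le
    exact mul_nonneg this (hpos x)
  · change ((g 1)⁻¹ : ℂ) * F 1 = 1
    rw [hF1]
    exact inv_mul_cancel₀ (by exact_mod_cast hg1.ne')
  · change ((g 1)⁻¹ : ℂ) * F (star a * a) ≠ 0
    rw [hF]
    refine mul_ne_zero (inv_ne_zero (by exact_mod_cast hg1.ne')) (by exact_mod_cast hFa.ne')

/-- A state, as a positive linear functional. -/
def positiveOfState [PartialOrder B] [StarOrderedRing B] {f : WeakDual ℂ B}
    (hf : f ∈ stateSpace B) : B →ₚ[ℂ] ℂ :=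
  PositiveLinearMap.mk₀ (f : B →ₗ[ℂ] ℂ) (fun x hx => by
      obtain ⟨y, rfl⟩ := CStarAlgebra.nonneg_iff_eq_star_mul_self.mp hx
      exact hf.1 y)

@[simp]
theorem positiveOfState_apply [PartialOrder B] [StarOrderedRing B] {f : WeakDual ℂ B}
    (hf : f ∈ stateSpace B) (a : B) : positiveOfState hf a = f a := rfl

theorem norm_apply_le_of_mem_stateSpace {f : WeakDual ℂ B} (hf : f ∈ stateSpace B) (a : B) :
    ‖f a‖ ≤ ‖a‖ := by
  let _ := CStarAlgebra.spectralOrder B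
  have := CStarAlgebra.spectralOrderedRing B
  let φ := positiveOfState hf
  have h1 := norm_inner_le_norm (𝕜 := ℂ) (φ.toPreGNS 1) (φ.toPreGNS a)
  have e1 : ‖φ.toPreGNS 1‖ = 1 := by
    rw [PositiveLinearMap.preGNS_norm_def]
    simp [φ, hf.2]
  have e2 : ‖φ.toPreGNS a‖ ≤ ‖a‖ := by
    rw [PositiveLinearMap.preGNS_norm_def]
    refine Real.sqrt_le_iff.mpr ⟨norm_nonneg _, ?_⟩
    have := φ.norm_apply_le_of_nonneg (star a * a) (star_mul_self_nonneg a)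
    rw [show φ 1 = 1 from hf.2, CStarRing.norm_star_mul_self] at this
    simp only [PositiveLinearMap.ofPreGNS_toPreGNS]
    refine (Complex.re_le_norm _).trans (this.trans ?_)
    simp [sq]
  rw [PositiveLinearMap.preGNS_inner_def] at h1
  simp only [PositiveLinearMap.ofPreGNS_toPreGNS, star_one, one_mul, e1] at h1
  exact h1.trans e2

theorem isCompact_stateSpace : IsCompact (stateSpace B) := by
  apply WeakDual.isCompact_of_bounded_of_closed
  · refine (Metric.isBounded_closedBall (x := (0 : StrongDual ℂ B)) (r := 1)).subset fun f hf => ?_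
    rw [mem_closedBall_zero_iff]
    exact ContinuousLinearMap.opNorm_le_bound _ zero_le_one fun a => by
      rw [one_mul]; exact norm_apply_le_of_mem_stateSpace hf a
  · have : stateSpace B = (⋂ a : B, {f | 0 ≤ f (star a * a)}) ∩ {f | f 1 = 1} := by
      ext f; simp [stateSpace]
    rw [this]
    refine (isClosed_iInter fun a => ?_).inter ?_
    · exact isClosed_Ici.preimage (WeakDual.eval_continuous (star a * a))
    · exact isClosed_singleton.preimage (WeakDual.eval_continuous (1 : B))

theorem convex_stateSpace : Convex ℝ (stateSpace B) := by
  intro f hf g hg s t hs ht hst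
  refine ⟨fun a => ?_, ?_⟩
  · change 0 ≤ s • f (star a * a) + t • g (star a * a)
    exact add_nonneg (smul_nonneg hs (hf.1 a)) (smul_nonneg ht (hg.1 a))
  · change s • f 1 + t • g 1 = 1
    rw [hf.2, hg.2, ← add_smul, hst, one_smul]

theorem exists_extremePoint_stateSpace_apply_ne_zero {a : B} (ha : a ≠ 0) :
    ∃ f ∈ (stateSpace B).extremePoints ℝ, f (star a * a) ≠ 0 := by
  by_contra! h
  obtain ⟨f, hf, hfa⟩ := exists_mem_stateSpace_apply_ne_zero ha
  have hK := @closure_convexHull_extremePoints (WeakDual ℂ B) _ _ _ _ _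
    (WeakDual.instContinuousSMul ℝ) (WeakBilin.locallyConvexSpace (B := topDualPairing ℂ B))
    (stateSpace B) isCompact_stateSpace convex_stateSpace
  rw [← hK] at hf
  refine hfa (closure_minimal
    (convexHull_min (t := {f : WeakDual ℂ B | f (star a * a) = 0}) h ?_) ?_ hf)
  · intro f hf g hg s t hs ht hst
    change s • f (star a * a) + t • g (star a * a) = 0
    rw [show f (star a * a) = 0 from hf, show g (star a * a) = 0 from hg]; simp
  · exact isClosed_singleton.preimage (WeakDual.eval_continuous (star a * a))

end States

section GNS

variable {B : Type*} [CStarAlgebra B]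

/-- The GNS representation of a pure state is irreducible. -/
theorem isIrreducibleRep_gns [PartialOrder B] [StarOrderedRing B] {f : WeakDual ℂ B}
    (hf : f ∈ stateSpace B) (hext : f ∈ (stateSpace B).extremePoints ℝ) :
    IsIrreducibleRep (positiveOfState hf).gnsNonUnitalStarAlgHom := by
  set φ := positiveOfState hf with hφ
  set π := φ.gnsNonUnitalStarAlgHom with hπ
  let ξ : φ.GNS := ((φ.toPreGNS 1 : φ.PreGNS) : UniformSpace.Completion φ.PreGNS)
  have hπξ (a : B) : π a ξ = ((φ.toPreGNS a : φ.PreGNS) : UniformSpace.Completion φ.PreGNS) := by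
    simp [hπ, ξ]
  have hinner (a : B) : ⟪ξ, π a ξ⟫_ℂ = f a := by
    rw [hπξ, UniformSpace.Completion.inner_coe, PositiveLinearMap.preGNS_inner_def]
    simp [φ]
  have hdense : DenseRange fun a : B => π a ξ := by
    have := UniformSpace.Completion.denseRange_coe (α := φ.PreGNS)
    have h2 : (fun a : B => π a ξ) =
        (fun x : φ.PreGNS => (x : UniformSpace.Completion φ.PreGNS)) ∘ φ.toPreGNS :=
      funext hπξ
    rw [h2]
    exact this.comp φ.toPreGNS.surjective.denseRange (UniformSpace.Completion.continuous_coe _)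
  have hξ : ⟪ξ, ξ⟫_ℂ = 1 := by
    have := hinner 1
    rwa [hf.2, show π 1 ξ = ξ from hπξ 1] at this
  refine ⟨⟨1, fun h0 => ?_⟩, fun S hS hinv => ?_⟩
  · have h1 := hπξ 1
    rw [h0] at h1
    have : ξ = 0 := h1.symm
    rw [this] at hξ
    simp at hξ
  have : CompleteSpace S := hS.completeSpace_coe
  have key (U : Submodule ℂ φ.GNS) [U.HasOrthogonalProjection]
      (hU : ∀ a, U.starProjection * π a = π a * U.starProjection)
      (h0 : U.starProjection ξ = 0) : U = ⊥ := by
    have h1 : U.starProjection = 0 := by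
      have : (U.starProjection : φ.GNS → φ.GNS) = fun _ => 0 := by
        refine hdense.equalizer U.starProjection.continuous continuous_const ?_
        ext1 a
        change (U.starProjection * π a) ξ = 0
        rw [hU]
        change π a (U.starProjection ξ) = 0
        rw [h0, map_zero]
      ext1 v
      exact congrFun this v
    rw [Submodule.eq_bot_iff]
    intro v hv
    rw [← Submodule.starProjection_eq_self_iff.mpr hv, h1]; simp
  have hcomm (a : B) : S.starProjection * π a = π a * S.starProjection :=
    S.starProjection_commute_of_invariant _ (hinv a) (by
      rw [← map_star]; exact hinv _)
  have hcomm' (a : B) : Sᗮ.starProjection * π a = π a * Sᗮ.starProjection := by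
    rw [Submodule.starProjection_orthogonal', sub_mul, mul_sub, hcomm]; simp
  by_cases hp0 : S.starProjection ξ = 0
  · exact Or.inl (key S hcomm hp0)
  by_cases hq0 : Sᗮ.starProjection ξ = 0
  · exact Or.inr (Submodule.orthogonal_eq_bot_iff.mp (key Sᗮ hcomm' hq0))
  exfalso
  have hst (U : Submodule ℂ φ.GNS) [U.HasOrthogonalProjection]
      (hU : ∀ a, U.starProjection * π a = π a * U.starProjection)
      (h0 : U.starProjection ξ ≠ 0) :
      ∃ g ∈ stateSpace B, ∀ a, (‖U.starProjection ξ‖ ^ 2) • g a = ⟪U.starProjection ξ, π a ξ⟫_ℂ := by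
    set η := U.starProjection ξ with hη
    have hη' : ‖η‖ ^ 2 ≠ 0 := by simpa using h0
    have hidem : U.starProjection η = η :=
      Submodule.starProjection_eq_self_iff.mpr (U.starProjection_apply_mem ξ)
    have hπη (a : B) : ⟪η, π a η⟫_ℂ = ⟪η, π a ξ⟫_ℂ := by
      have : π a η = U.starProjection (π a ξ) := by
        change _ = (U.starProjection * π a) ξ
        rw [hU]; rfl
      rw [this, ← Submodule.inner_starProjection_left_eq_right, hidem]
    let g : B →L[ℂ] ℂ := (‖η‖ ^ 2)⁻¹ • LinearMap.mkContinuous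
      { toFun := fun a => ⟪η, π a η⟫_ℂ
        map_add' := fun a b => by simp [inner_add_right]
        map_smul' := fun c a => by simp [inner_smul_right] } (‖η‖ ^ 2) (fun a => by
          change ‖⟪η, π a η⟫_ℂ‖ ≤ _
          refine (norm_inner_le_norm _ _).trans ?_
          have h1 := (π a).le_opNorm η
          have h2 := NonUnitalStarAlgHom.norm_apply_le π a
          have h3 : ‖π a η‖ ≤ ‖a‖ * ‖η‖ :=
            h1.trans (mul_le_mul_of_nonneg_right h2 (norm_nonneg _))
          calc ‖η‖ * ‖π a η‖ ≤ ‖η‖ * (‖a‖ * ‖η‖) := by gcongr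
            _ = _ := by ring)
    have hg (a : B) : g a = (‖η‖ ^ 2)⁻¹ • ⟪η, π a η⟫_ℂ := rfl
    refine ⟨g, ⟨fun a => ?_, ?_⟩, fun a => ?_⟩
    · change 0 ≤ g (star a * a)
      rw [hg]
      refine smul_nonneg (by positivity) ?_
      rw [map_mul, map_star]
      change 0 ≤ ⟪η, (ContinuousLinearMap.adjoint (π a)) (π a η)⟫_ℂ
      rw [ContinuousLinearMap.adjoint_inner_right, inner_self_eq_norm_sq_to_K]
      positivity
    · change g 1 = 1
      rw [hg, hπη, show π 1 ξ = ξ from hπξ 1, ← hidem, Submodule.inner_starProjection_left_eq_right,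
        ← hη, hidem, inner_self_eq_norm_sq_to_K]
      rw [Complex.real_smul]
      push_cast
      exact inv_mul_cancel₀ (by exact_mod_cast hη')
    · change _ • g a = _
      rw [hg, smul_smul, mul_inv_cancel₀ hη', one_smul, hπη]
  obtain ⟨g, hgS, hg⟩ := hst S hcomm hp0
  obtain ⟨h, hhS, hh⟩ := hst Sᗮ hcomm' hq0
  set p := ‖S.starProjection ξ‖ ^ 2 with hp
  set q := ‖Sᗮ.starProjection ξ‖ ^ 2 with hq
  have hp_pos : 0 < p := by positivity
  have hq_pos : 0 < q := by positivity
  have hsum : S.starProjection ξ + Sᗮ.starProjection ξ = ξ :=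
    Submodule.starProjection_add_starProjection_orthogonal ξ
  have hdecomp (a : B) : p • g a + q • h a = f a := by
    rw [hg, hh, ← inner_add_left, hsum, hinner]
  have hpq : p + q = 1 := by
    have := hdecomp 1
    rw [hgS.2, hhS.2, hf.2] at this
    simp only [Complex.real_smul, mul_one] at this
    exact_mod_cast this
  have hgf : g = f := by
    refine hext.2 hgS hhS ⟨p, q, hp_pos, hq_pos, hpq, ?_⟩
    exact DFunLike.ext _ _ hdecomp
  rw [hgf] at hg
  have hPξ : S.starProjection ξ = (p : ℂ) • ξ := by
    have : (fun v => ⟪S.starProjection ξ, v⟫_ℂ) = fun v => ⟪(p : ℂ) • ξ, v⟫_ℂ := by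
      refine hdense.equalizer (by fun_prop) (by fun_prop) ?_
      ext1 a
      change ⟪S.starProjection ξ, π a ξ⟫_ℂ = ⟪(p : ℂ) • ξ, π a ξ⟫_ℂ
      rw [← hg, inner_smul_left, hinner, Complex.conj_ofReal, Complex.real_smul]
    exact ext_inner_right ℂ (congrFun this)
  have hp1 : (p : ℂ) • S.starProjection ξ = (1 : ℂ) • S.starProjection ξ := by
    rw [← map_smul, ← hPξ, one_smul]
    exact Submodule.starProjection_eq_self_iff.mpr (S.starProjection_apply_mem ξ)
  have hp1' : (p : ℂ) = 1 := smul_left_injective ℂ hp0 hp1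
  have : p = 1 := by exact_mod_cast hp1'
  linarith

/-- Irreducible representations separate the points of a unital C*-algebra. -/
theorem exists_isIrreducibleRep_apply_ne_zero {B : Type} [CStarAlgebra B] {a : B} (ha : a ≠ 0) :
    ∃ (H : Type) (_ : NormedAddCommGroup H) (_ : InnerProductSpace ℂ H) (_ : CompleteSpace H)
      (π : B →⋆ₙₐ[ℂ] (H →L[ℂ] H)), IsIrreducibleRep π ∧ π a ≠ 0 := by
  let _ := CStarAlgebra.spectralOrder B
  have := CStarAlgebra.spectralOrderedRing B
  obtain ⟨f, hext, hfa⟩ := exists_extremePoint_stateSpace_apply_ne_zero ha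
  have hf := extremePoints_subset hext
  refine ⟨(positiveOfState hf).GNS, inferInstance, inferInstance, inferInstance,
    (positiveOfState hf).gnsNonUnitalStarAlgHom, isIrreducibleRep_gns hf hext, fun h => hfa ?_⟩
  set φ := positiveOfState hf
  have h1 : φ.gnsNonUnitalStarAlgHom a ((φ.toPreGNS 1 : φ.PreGNS) : UniformSpace.Completion φ.PreGNS)
      = ((φ.toPreGNS a : φ.PreGNS) : UniformSpace.Completion φ.PreGNS) := by
    simp
  rw [h] at h1
  have h2 : ‖φ.toPreGNS a‖ = 0 := by
    rw [← UniformSpace.Completion.norm_coe, ← h1]; simp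
  have h3 := φ.preGNS_norm_sq (φ.toPreGNS a)
  rw [h2] at h3
  simpa [φ] using h3.symm

end GNS

section DirectSum

variable {ι A : Type*} [NonUnitalCStarAlgebra A] {H : ι → Type*} [∀ i, NormedAddCommGroup (H i)]
  [∀ i, InnerProductSpace ℂ (H i)]

theorem lp_two_clm_ext [DecidableEq ι] {E : Type*} [NormedAddCommGroup E] [NormedSpace ℂ E]
    {F G : lp H 2 →L[ℂ] E} (h : ∀ i v, F (lp.single 2 i v) = G (lp.single 2 i v)) : F = G := by
  ext1 f
  have hf := lp.hasSum_single (p := 2) (by simp) f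
  refine (hf.mapL F).unique ?_
  convert hf.mapL G using 2
  exact h _ _

variable [∀ i, CompleteSpace (H i)]

theorem norm_rep_apply_le_norm_smul (π : ∀ i, A →⋆ₙₐ[ℂ] (H i →L[ℂ] H i)) (a : A) (f : lp H 2)
    (i : ι) : ‖π i a (f i)‖ ≤ ‖(((‖a‖ : ℂ) • f : lp H 2) : ∀ i, H i) i‖ := by
  have h1 := (π i a).le_opNorm (f i)
  have h2 := NonUnitalStarAlgHom.norm_apply_le (π i) a
  rw [lp.coeFn_smul, Pi.smul_apply, norm_smul]
  simp only [Complex.norm_real, norm_norm]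
  exact h1.trans (mul_le_mul_of_nonneg_right h2 (norm_nonneg _))

/-- The Hilbert space direct sum of a family of representations of a C*-algebra. -/
def directSumRep (π : ∀ i, A →⋆ₙₐ[ℂ] (H i →L[ℂ] H i)) : A →⋆ₙₐ[ℂ] (lp H 2 →L[ℂ] lp H 2) where
  toFun a := LinearMap.mkContinuous
    { toFun := fun f => ⟨fun i => π i a (f i),
        (lp.memℓp ((‖a‖ : ℂ) • f)).mono' (norm_rep_apply_le_norm_smul π a f)⟩
      map_add' := fun f g => by ext i; simp; rfl
      map_smul' := fun c f => by ext i; simp } ‖a‖ (fun f => by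
        refine (lp.norm_mono (y := ((‖a‖ : ℂ) • f : lp H 2)) (by simp)
          (norm_rep_apply_le_norm_smul π a f)).trans ?_
        rw [norm_smul]; simp)
  map_smul' c a := by ext f i; simp
  map_zero' := by ext f i; simp
  map_add' a b := by ext f i; simp; rfl
  map_mul' a b := by ext f i; simp
  map_star' a := by
    refine (ContinuousLinearMap.eq_adjoint_iff _ _).mpr fun f g => ?_
    rw [lp.inner_eq_tsum, lp.inner_eq_tsum]
    refine tsum_congr fun i => ?_
    change ⟪π i (star a) (f i), g i⟫_ℂ = ⟪f i, π i a (g i)⟫_ℂ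
    rw [map_star]
    exact ContinuousLinearMap.adjoint_inner_left _ _ _

@[simp]
theorem directSumRep_apply (π : ∀ i, A →⋆ₙₐ[ℂ] (H i →L[ℂ] H i)) (a : A) (f : lp H 2) (i : ι) :
    directSumRep π a f i = π i a (f i) := rfl

theorem directSumRep_single [DecidableEq ι] (π : ∀ i, A →⋆ₙₐ[ℂ] (H i →L[ℂ] H i)) (a : A) (i : ι)
    (v : H i) : directSumRep π a (lp.single 2 i v) = lp.single 2 i (π i a v) := by
  ext j
  by_cases h : j = i
  · subst h; simp
  · simp [h]

end DirectSum

section DoubleCommutant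

variable {H : Type*} [NormedAddCommGroup H] [InnerProductSpace ℂ H] [CompleteSpace H]

/-- A part of **von Neumann's double commutant theorem**: every operator in the double commutant of
a unital `*`-algebra of operators lies in its closure for the strong operator topology. -/
theorem mem_closure_of_mem_centralizer_centralizer (S : StarSubalgebra ℂ (H →L[ℂ] H))
    {T : H →L[ℂ] H} (hT : T ∈ Set.centralizer (Set.centralizer (S : Set (H →L[ℂ] H)))) :
    (T : H → H) ∈ closure ((fun s : H →L[ℂ] H => (s : H → H)) '' (S : Set (H →L[ℂ] H))) := by
  classical
  rw [mem_closure_iff]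
  intro U hU hTU
  obtain ⟨I, u, hu, hIU⟩ := isOpen_pi_iff.mp hU _ hTU
  let D : (H →L[ℂ] H) →⋆ₙₐ[ℂ] (lp (fun _ : I => H) 2 →L[ℂ] lp (fun _ : I => H) 2) :=
    directSumRep fun _ : I => NonUnitalStarAlgHom.id ℂ (H →L[ℂ] H)
  have hD (R : H →L[ℂ] H) (f : lp (fun _ : I => H) 2) (i : I) : D R f i = R (f i) := rfl
  have hDs (R : H →L[ℂ] H) (i : I) (v : H) :
      D R (lp.single (E := fun _ : I => H) 2 i v) = lp.single 2 i (R v) :=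
    directSumRep_single _ _ _ _
  let x : lp (fun _ : I => H) 2 := ⟨fun i => (i : H), Memℓp.all _⟩
  let L : (H →L[ℂ] H) →ₗ[ℂ] lp (fun _ : I => H) 2 :=
    { toFun := fun R => D R x
      map_add' := fun a b => by simp
      map_smul' := fun c a => by simp }
  let W₀ : Submodule ℂ (lp (fun _ : I => H) 2) := S.toSubalgebra.toSubmodule.map L
  let W := W₀.topologicalClosure
  have hWc : IsClosed (W : Set (lp (fun _ : I => H) 2)) := W₀.isClosed_topologicalClosure
  have : CompleteSpace W := hWc.completeSpace_coe
  have hinv (s : H →L[ℂ] H) (hs : s ∈ S) : ∀ w ∈ W, D s w ∈ W := by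
    have : Set.MapsTo (D s) (W₀ : Set (lp (fun _ : I => H) 2)) W₀ := by
      rintro _ ⟨r, hr, rfl⟩
      refine ⟨s * r, S.mul_mem hs hr, ?_⟩
      simp [L]
    intro w hw
    exact this.closure (D s).continuous hw
  have hcomm (s : H →L[ℂ] H) (hs : s ∈ S) : W.starProjection * D s = D s * W.starProjection := by
    refine W.starProjection_commute_of_invariant _ (hinv s hs) ?_
    rw [← map_star]
    exact hinv _ (star_mem hs)
  have hcommT : W.starProjection * D T = D T * W.starProjection := by
    refine lp_two_clm_ext fun j v => ?_
    ext i
    let R : H →L[ℂ] H :=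
      (ContinuousLinearMap.adjoint (lp.singleContinuousLinearMap ℂ (fun _ : I => H) 2 i)) ∘L
        W.starProjection ∘L (lp.singleContinuousLinearMap ℂ (fun _ : I => H) 2 j)
    have hR (v : H) : R v = W.starProjection (lp.single 2 j v) i := by
      refine ext_inner_left ℂ fun w => ?_
      simp only [R, ContinuousLinearMap.comp_apply, ContinuousLinearMap.adjoint_inner_right,
        lp.singleContinuousLinearMap_apply]
      exact lp.inner_single_left (𝕜 := ℂ) (G := fun _ : I => H) i w _
    have hRc : R ∈ Set.centralizer (S : Set (H →L[ℂ] H)) := by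
      intro s hs
      ext v
      change s (R v) = R (s v)
      rw [hR, hR, ← hDs, ← hD]
      exact congrArg (fun f : lp (fun _ : I => H) 2 => f i)
        (DFunLike.congr_fun (hcomm s hs) (lp.single (E := fun _ : I => H) 2 j v)).symm
    have hTR : R * T = T * R := hT R hRc
    have := DFunLike.congr_fun hTR v
    change R (T v) = T (R v) at this
    rw [hR, hR, ← hDs, ← hD] at this
    exact this
  have hxW : x ∈ W := by
    refine subset_closure ⟨1, S.one_mem, ?_⟩
    ext i
    rfl
  have hTx : D T x ∈ W := by
    rw [← Submodule.starProjection_eq_self_iff]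
    change (W.starProjection * D T) x = _
    rw [hcommT]
    change D T (W.starProjection x) = _
    rw [Submodule.starProjection_eq_self_iff.mpr hxW]
  have hopen : IsOpen {y : lp (fun _ : I => H) 2 | ∀ i : I, y i ∈ u i} := by
    rw [Set.ofPred_forall]
    refine isOpen_iInter_of_finite fun i => (hu i i.2).1.preimage ?_
    exact (continuous_apply i).comp (lp.uniformContinuous_coe).continuous
  obtain ⟨_, hy, s, hs, rfl⟩ := mem_closure_iff.mp hTx _ hopen fun i => (hu i i.2).2
  exact ⟨s, hIU fun i hi => hy ⟨i, hi⟩, s, hs, rfl⟩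

end DoubleCommutant

section Schur

variable {B : Type*} [Ring B] [StarRing B] [Algebra ℂ B] {H : Type*} [NormedAddCommGroup H]
  [InnerProductSpace ℂ H] [CompleteSpace H] {π : B →⋆ₙₐ[ℂ] (H →L[ℂ] H)}

theorem IsIrreducibleRep.ker_eq_bot_or_top (hπ : IsIrreducibleRep π) {T : H →L[ℂ] H}
    (hT : ∀ b, Commute T (π b)) :
    LinearMap.ker (T : H →ₗ[ℂ] H) = ⊥ ∨ LinearMap.ker (T : H →ₗ[ℂ] H) = ⊤ := by
  refine hπ.2 _ T.isClosed_ker fun b v hv => ?_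
  rw [LinearMap.mem_ker] at hv ⊢
  have h := DFunLike.congr_fun (hT b).eq v
  change T (π b v) = π b (T v) at h
  change T v = 0 at hv
  change T (π b v) = 0
  rw [h, hv, map_zero]

theorem IsIrreducibleRep.eq_zero_or_eq_zero_of_mul_eq_zero (hπ : IsIrreducibleRep π)
    {T R : H →L[ℂ] H} (hT : ∀ b, Commute T (π b)) (h : T * R = 0) : T = 0 ∨ R = 0 := by
  rcases hπ.ker_eq_bot_or_top hT with hk | hk
  · right
    ext v
    have : R v ∈ LinearMap.ker (T : H →ₗ[ℂ] H) := DFunLike.congr_fun h v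
    rw [hk] at this
    simpa using this
  · left
    ext v
    have : v ∈ LinearMap.ker (T : H →ₗ[ℂ] H) := by rw [hk]; trivial
    exact this

theorem IsIrreducibleRep.map_one (hπ : IsIrreducibleRep π) : π 1 = 1 := by
  have h : π 1 * (π 1 - 1) = 0 := by rw [mul_sub, ← map_mul]; simp
  have hc (b : B) : Commute (π 1) (π b) := by
    rw [Commute, SemiconjBy, ← map_mul, ← map_mul, one_mul, mul_one]
  rcases hπ.eq_zero_or_eq_zero_of_mul_eq_zero hc h with h0 | h0
  · obtain ⟨b, hb⟩ := hπ.1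
    exact absurd (by rw [← mul_one b, map_mul, h0, mul_zero]) hb
  · exact sub_eq_zero.mp h0

theorem IsIrreducibleRep.exists_eq_algebraMap_of_isSelfAdjoint (hπ : IsIrreducibleRep π)
    {T : H →L[ℂ] H} (hT : ∀ b, Commute T (π b)) (hsa : IsSelfAdjoint T) :
    ∃ r : ℝ, T = algebraMap ℝ _ r := by
  have key : (spectrum ℝ T).Subsingleton := by
    intro s hs t ht
    by_contra hst
    wlog hlt : s < t generalizing s t
    · exact this ht hs (Ne.symm hst) (lt_of_le_of_ne (not_lt.mp hlt) (Ne.symm hst))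
    let c := (s + t) / 2
    let f : ℝ → ℝ := fun x => max (x - c) 0
    let g : ℝ → ℝ := fun x => max (c - x) 0
    have hf : Continuous f := by fun_prop
    have hg : Continuous g := by fun_prop
    have hfg : cfc f T * cfc g T = 0 := by
      rw [← cfc_mul f g T hf.continuousOn hg.continuousOn, ← cfc_zero ℝ T]
      congr 1
      ext x
      rcases le_total x c with h | h
      · simp [f, h]
      · simp [g, h]
    rcases hπ.eq_zero_or_eq_zero_of_mul_eq_zero
      (fun b => (hT b).cfc_real f) hfg with h0 | h0
    · rw [← cfc_zero ℝ T] at h0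
      have := eqOn_of_cfc_eq_cfc h0 hf.continuousOn continuousOn_const hsa ht
      simp only [f, c, Pi.zero_apply, max_eq_right_iff] at this
      linarith
    · rw [← cfc_zero ℝ T] at h0
      have := eqOn_of_cfc_eq_cfc h0 hg.continuousOn continuousOn_const hsa hs
      simp only [g, c, Pi.zero_apply, max_eq_right_iff] at this
      linarith
  rcases key.eq_empty_or_singleton with h | ⟨r, h⟩
  · exact ⟨0, CFC.eq_algebraMap_of_spectrum_subset_singleton T 0 (by simp [h])⟩
  · exact ⟨r, CFC.eq_algebraMap_of_spectrum_subset_singleton T r h.subset⟩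

/-- **Schur's lemma**: an operator commuting with an irreducible representation is scalar. -/
theorem IsIrreducibleRep.exists_eq_algebraMap (hπ : IsIrreducibleRep π)
    {T : H →L[ℂ] H} (hT : ∀ b, Commute T (π b)) : ∃ z : ℂ, T = algebraMap ℂ _ z := by
  have hT' (b : B) : Commute (star T) (π b) := by
    have := (hT (star b)).star_star
    rwa [← map_star, star_star] at this
  obtain ⟨r, hr⟩ := hπ.exists_eq_algebraMap_of_isSelfAdjoint (T := (realPart T : H →L[ℂ] H))
    (fun b => by
      rw [realPart_apply_coe]
      exact ((hT b).add_left (hT' b)).smul_left _) (realPart T).2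
  obtain ⟨s, hs⟩ := hπ.exists_eq_algebraMap_of_isSelfAdjoint (T := (imaginaryPart T : H →L[ℂ] H))
    (fun b => by
      rw [imaginaryPart_apply_coe]
      exact (((hT b).sub_left (hT' b)).smul_left _).smul_left _) (imaginaryPart T).2
  refine ⟨r + Complex.I * s, ?_⟩
  rw [← realPart_add_I_smul_imaginaryPart T, hr, hs]
  ext v
  simp [Algebra.algebraMap_eq_smul_one, add_smul, mul_smul]

/-- An irreducible representation of a unital algebra, as a unital `*`-homomorphism. -/
def IsIrreducibleRep.toStarAlgHom (hπ : IsIrreducibleRep π) : B →⋆ₐ[ℂ] (H →L[ℂ] H) :=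
  { π with
    map_one' := hπ.map_one
    commutes' := fun z => by
      change π (algebraMap ℂ B z) = _
      rw [Algebra.algebraMap_eq_smul_one, map_smul, hπ.map_one, Algebra.algebraMap_eq_smul_one] }

/-- The image of an irreducible representation is dense for the strong operator topology. -/
theorem IsIrreducibleRep.mem_closure_range (hπ : IsIrreducibleRep π) (T : H →L[ℂ] H) :
    (T : H → H) ∈ closure ((fun s : H →L[ℂ] H => (s : H → H)) ''
      (hπ.toStarAlgHom.range : Set (H →L[ℂ] H))) := by
  refine mem_closure_of_mem_centralizer_centralizer _ fun R hR => ?_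
  obtain ⟨z, rfl⟩ := hπ.exists_eq_algebraMap (T := R) fun b => (hR _ ⟨b, rfl⟩).symm
  exact Algebra.commutes z T

end Schur

section Capelli

variable {R S : Type*} [Ring R] [Algebra ℂ R] [Ring S] [Algebra ℂ S] {m : ℕ}

/-- The Capelli polynomial `∑ σ, sign σ • ∏ k, a k * x (σ k) * b k`. -/
def capelli (a b x : Fin m → R) : R :=
  ∑ σ : Equiv.Perm (Fin m),
    Equiv.Perm.sign σ • (List.ofFn fun k => a k * x (σ k) * b k).prod

theorem map_capelli {F : Type*} [FunLike F R S] [AlgHomClass F ℂ R S] (f : F)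
    (a b x : Fin m → R) : f (capelli a b x) = capelli (f ∘ a) (f ∘ b) (f ∘ x) := by
  simp only [capelli, map_sum, Function.comp_apply, ← map_mul]
  refine Finset.sum_congr rfl fun σ _ => ?_
  rw [Units.smul_def, Units.smul_def, map_zsmul, map_list_prod, List.map_ofFn]
  rfl

theorem capelli_eq_zero_of_not_linearIndependent (a b : Fin m → R) {x : Fin m → R}
    (hx : ¬ LinearIndependent ℂ x) : capelli a b x = 0 := by
  let f : R [⋀^Fin m]→ₗ[ℂ] R := MultilinearMap.alternatization
    ((MultilinearMap.mkPiAlgebraFin ℂ m R).compLinearMap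
      fun k => LinearMap.mulLeftRight ℂ (a k, b k))
  have := f.map_linearDependent x hx
  rw [MultilinearMap.alternatization_apply] at this
  simpa [capelli] using this

end Capelli

section StandardIdentity

variable {H : Type*} [NormedAddCommGroup H] [InnerProductSpace ℂ H]

theorem capelli_eq_zero_of_rank_le {n m : ℕ} (hH : Module.rank ℂ H ≤ n) (hm : n * n < m)
    (a b x : Fin m → (H →L[ℂ] H)) : capelli a b x = 0 := by
  have hfin : Module.Finite ℂ H :=
    Module.rank_lt_aleph0_iff.mp (hH.trans_lt (Cardinal.natCast_lt_aleph0))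
  refine capelli_eq_zero_of_not_linearIndependent a b fun hx => ?_
  have h1 : LinearIndependent ℂ fun k => (x k : H →ₗ[ℂ] H) :=
    hx.map' (ContinuousLinearMap.coeLM ℂ)
      (LinearMap.ker_eq_bot.mpr ContinuousLinearMap.coe_injective)
  have h2 := h1.fintype_card_le_finrank
  rw [Module.finrank_linearMap, Fintype.card_fin] at h2
  have h3 : Module.finrank ℂ H ≤ n := Module.finrank_le_of_rank_le hH
  have := Nat.mul_le_mul h3 h3
  omega

theorem rank_le_of_capelli_eq_zero {n : ℕ}
    (h : ∀ a b x : Fin ((n + 1) * (n + 1)) → (H →L[ℂ] H), capelli a b x = 0) :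
    Module.rank ℂ H ≤ n := by
  by_contra! hlt
  have hle : ((n + 1 : ℕ) : Cardinal) ≤ Module.rank ℂ H := by
    rw [Nat.cast_succ, ← Cardinal.succ_natCast]
    exact Order.succ_le_of_lt hlt
  obtain ⟨v, hv⟩ := Module.le_rank_iff.mp hle
  let e := InnerProductSpace.gramSchmidtNormed ℂ v
  have he : Orthonormal ℂ e := InnerProductSpace.gramSchmidtNormed_orthonormal hv
  have hee (i j : Fin (n + 1)) : ⟪e i, e j⟫_ℂ = if i = j then 1 else 0 :=
    orthonormal_iff_ite.mp he i j
  let E (i j : Fin (n + 1)) : H →L[ℂ] H := InnerProductSpace.rankOne ℂ (e i) (e j)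
  have hE (i j k l : Fin (n + 1)) : E i j * E k l = if j = k then E i l else 0 := by
    ext v
    simp only [E, mul_apply_eq_comp, InnerProductSpace.rankOne_apply, inner_smul_right,
      hee]
    split_ifs <;> simp
  let p : Fin ((n + 1) * (n + 1)) ≃ Fin (n + 1) × Fin (n + 1) := finProdFinEquiv.symm
  have h0 := h (fun k => E 0 (p k).1) (fun k => E (p k).2 0) (fun k => E (p k).1 (p k).2)
  have hterm (k l) : E 0 (p k).1 * E (p l).1 (p l).2 * E (p k).2 0
      = if k = l then E 0 0 else 0 := by
    rw [hE]
    by_cases hkl : k = l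
    · simp [hkl, hE]
    · by_cases h1 : (p k).1 = (p l).1
      · have h2 : (p l).2 ≠ (p k).2 := fun h2 => hkl (p.injective (Prod.ext h1 h2.symm))
        simp [h1, hE, h2, hkl]
      · simp [h1, hkl]
  rw [capelli, Finset.sum_eq_single 1] at h0
  · have h1 : ∀ m : ℕ, ((E 0 0) ^ m) (e 0) = e 0 := by
      intro m
      induction m with
      | zero => rfl
      | succ m ih =>
        rw [pow_succ, mul_apply_eq_comp]
        have : E 0 0 (e 0) = e 0 := by simp [E, InnerProductSpace.rankOne_apply, he.1 0]
        rw [this, ih]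
    simp only [Equiv.Perm.coe_one, id, hterm, if_true, List.ofFn_const, List.prod_replicate,
      map_one, one_smul] at h0
    have := h1 ((n + 1) * (n + 1))
    rw [h0] at this
    exact he.ne_zero 0 this.symm
  · intro σ _ hσ
    obtain ⟨k, hk⟩ : ∃ k, σ k ≠ k := by
      by_contra! hc
      exact hσ (Equiv.ext hc)
    rw [List.prod_eq_zero, smul_zero]
    refine List.mem_ofFn.mpr ⟨k, ?_⟩
    rw [hterm, if_neg (Ne.symm hk)]
  · simp

end StandardIdentity

section StrongClosure

variable {H : Type*} [NormedAddCommGroup H] [InnerProductSpace ℂ H]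

/-- Continuity from the strong operator topology to itself. -/
def IsStrongContinuous (F : (H →L[ℂ] H) → (H →L[ℂ] H)) : Prop :=
  ∀ u, ∃ φ : (H → H) → H, Continuous φ ∧ ∀ T, F T u = φ T

namespace IsStrongContinuous

variable {F G : (H →L[ℂ] H) → (H →L[ℂ] H)}

theorem id : IsStrongContinuous fun T : H →L[ℂ] H => T :=
  fun u => ⟨fun f => f u, continuous_apply u, fun _ => rfl⟩

theorem const_mul (hF : IsStrongContinuous F) (C : H →L[ℂ] H) :
    IsStrongContinuous fun T => C * F T := fun u => by
  obtain ⟨φ, hφ, h⟩ := hF u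
  exact ⟨fun f => C (φ f), C.continuous.comp hφ, fun T => congrArg C (h T)⟩

theorem mul_const (hF : IsStrongContinuous F) (C : H →L[ℂ] H) :
    IsStrongContinuous fun T => F T * C := fun u => hF (C u)

theorem sum {ι : Type*} {s : Finset ι} {F : ι → (H →L[ℂ] H) → (H →L[ℂ] H)}
    (hF : ∀ i ∈ s, IsStrongContinuous (F i)) : IsStrongContinuous fun T => ∑ i ∈ s, F i T :=
  fun u => by
  choose! φ hφ h using fun i hi => hF i hi u
  refine ⟨fun f => ∑ i ∈ s, φ i f, continuous_finsetSum _ hφ, fun T => ?_⟩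
  rw [sum_apply]
  exact Finset.sum_congr rfl fun i hi => h i hi T

theorem prod_ofFn {m : ℕ} {F : Fin m → (H →L[ℂ] H) → (H →L[ℂ] H)} (k : Fin m)
    (hF : IsStrongContinuous (F k)) (hc : ∀ j ≠ k, ∀ T, F j T = F j 0) :
    IsStrongContinuous fun T => (List.ofFn fun j => F j T).prod := by
  induction m with
  | zero => exact k.elim0
  | succ m ih =>
    simp only [List.ofFn_succ, List.prod_cons]
    by_cases hk : k = 0
    · subst hk
      have htail (T) : (List.ofFn fun j : Fin m => F j.succ T) =
          List.ofFn fun j : Fin m => F j.succ 0 :=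
        congrArg List.ofFn (funext fun j => hc _ (Fin.succ_ne_zero j) T)
      simp only [htail]
      exact hF.mul_const _
    · obtain ⟨k, rfl⟩ := Fin.exists_succ_eq.mpr hk
      simp only [hc 0 (Fin.succ_ne_zero k).symm]
      refine const_mul (ih k hF fun j hj => hc _ ?_) _
      exact fun h => hj (Fin.succ_injective _ h)

theorem eq_zero_of_mem_closure (hF : IsStrongContinuous F) {S : Set (H →L[ℂ] H)}
    (hS : ∀ T ∈ S, F T = 0) {T : H →L[ℂ] H}
    (hT : (T : H → H) ∈ closure ((fun s : H →L[ℂ] H => (s : H → H)) '' S)) : F T = 0 := by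
  ext u
  obtain ⟨φ, hφ, h⟩ := hF u
  have hcl : IsClosed {f | φ f = 0} := isClosed_eq hφ continuous_const
  rw [h]
  refine closure_minimal ?_ hcl hT
  rintro _ ⟨s, hs, rfl⟩
  change φ s = 0
  rw [← h, hS s hs]
  rfl

end IsStrongContinuous

/-- A separately strongly continuous function vanishing on a set of operators vanishes on its strong
closure. -/
theorem eq_zero_of_forall_mem_closure {ι : Type*} [Finite ι] [DecidableEq ι]
    {F : (ι → (H →L[ℂ] H)) → (H →L[ℂ] H)}
    (hF : ∀ x i, IsStrongContinuous fun T => F (Function.update x i T)) {S : Set (H →L[ℂ] H)}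
    (hS : ∀ x, (∀ i, x i ∈ S) → F x = 0) {x : ι → (H →L[ℂ] H)}
    (hx : ∀ i, (x i : H → H) ∈ closure ((fun s : H →L[ℂ] H => (s : H → H)) '' S)) : F x = 0 := by
  have := Fintype.ofFinite ι
  suffices h : ∀ s : Finset ι, ∀ x : ι → (H →L[ℂ] H), (∀ i ∉ s, x i ∈ S) →
      (∀ i ∈ s, (x i : H → H) ∈ closure ((fun s : H →L[ℂ] H => (s : H → H)) '' S)) → F x = 0 from
    h Finset.univ x (by simp) fun i _ => hx i
  intro s
  induction s using Finset.induction_on with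
  | empty => exact fun x hx _ => hS x fun i => hx i (by simp)
  | insert i s hi ih =>
    intro x hx hxs
    rw [← Function.update_eq_self i x]
    refine (hF x i).eq_zero_of_mem_closure (fun T hT => ih _ (fun j hj => ?_) fun j hj => ?_)
      (hxs i (by simp))
    · by_cases hji : j = i
      · subst hji; simpa using hT
      · rw [Function.update_of_ne hji]
        exact hx j (by simp [hji, hj])
    · have hji : j ≠ i := fun h => hi (h ▸ hj)
      rw [Function.update_of_ne hji]
      exact hxs j (by simp [hj])

theorem isStrongContinuous_capelli {m : ℕ}
    {a b x : (H →L[ℂ] H) → Fin m → (H →L[ℂ] H)} (k : Equiv.Perm (Fin m) → Fin m)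
    (hF : ∀ σ, IsStrongContinuous fun T => a T (k σ) * x T (σ (k σ)) * b T (k σ))
    (hc : ∀ σ, ∀ j ≠ k σ, ∀ T, a T j * x T (σ j) * b T j = a 0 j * x 0 (σ j) * b 0 j) :
    IsStrongContinuous fun T => capelli (a T) (b T) (x T) := by
  refine IsStrongContinuous.sum fun σ _ => ?_
  have := (IsStrongContinuous.prod_ofFn (F := fun j T => a T j * x T (σ j) * b T j) (k σ)
    (hF σ) (hc σ)).const_mul ((Equiv.Perm.sign σ : ℤ) : H →L[ℂ] H)
  simpa only [Units.smul_def, zsmul_eq_mul] using this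

/-- If the Capelli polynomial vanishes on a set of operators, it vanishes on the strong closure. -/
theorem capelli_eq_zero_of_mem_closure {m : ℕ} {S : Set (H →L[ℂ] H)}
    (hS : ∀ a b x : Fin m → (H →L[ℂ] H), (∀ k, a k ∈ S) → (∀ k, b k ∈ S) → (∀ k, x k ∈ S) →
      capelli a b x = 0) {a b x : Fin m → (H →L[ℂ] H)}
    (ha : ∀ k, (a k : H → H) ∈ closure ((fun s : H →L[ℂ] H => (s : H → H)) '' S))
    (hb : ∀ k, (b k : H → H) ∈ closure ((fun s : H →L[ℂ] H => (s : H → H)) '' S))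
    (hx : ∀ k, (x k : H → H) ∈ closure ((fun s : H →L[ℂ] H => (s : H → H)) '' S)) :
    capelli a b x = 0 := by
  refine eq_zero_of_forall_mem_closure (F := fun a => capelli a b x) (fun a i => ?_)
    (fun a haS => ?_) ha
  · refine isStrongContinuous_capelli (a := fun T => Function.update a i T) (b := fun _ => b)
      (x := fun _ => x) (fun _ => i) (fun σ => ?_) fun σ j hj T => ?_
    · simpa using (IsStrongContinuous.id.mul_const _).mul_const _
    · simp [hj]
  refine eq_zero_of_forall_mem_closure (F := fun b => capelli a b x) (fun b i => ?_)
    (fun b hbS => ?_) hb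
  · refine isStrongContinuous_capelli (a := fun _ => a) (b := fun T => Function.update b i T)
      (x := fun _ => x) (fun _ => i) (fun σ => ?_) fun σ j hj T => ?_
    · simpa using IsStrongContinuous.id.const_mul _
    · simp [hj]
  refine eq_zero_of_forall_mem_closure (F := fun x => capelli a b x) (fun x i => ?_)
    (fun x hxS => hS a b x haS hbS hxS) hx
  refine isStrongContinuous_capelli (a := fun _ => a) (b := fun _ => b)
    (x := fun T => Function.update x i T) (fun σ => σ.symm i) (fun σ => ?_) fun σ j hj T => ?_
  · simpa using (IsStrongContinuous.id.const_mul _).mul_const _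
  · have : σ j ≠ i := fun h => hj (by simp [← h])
    simp [this]

end StrongClosure

section Subhomogeneous

theorem rank_le_one_of_forall_isClosed {H : Type*} [NormedAddCommGroup H] [InnerProductSpace ℂ H]
    (h : ∀ S : Submodule ℂ H, IsClosed (S : Set H) → S = ⊥ ∨ S = ⊤) : Module.rank ℂ H ≤ 1 := by
  by_cases hv : ∃ v : H, v ≠ 0
  · obtain ⟨v, hv⟩ := hv
    refine rank_le_one_iff.mpr ⟨v, fun w => ?_⟩
    rcases h (ℂ ∙ v) (Submodule.closed_of_finiteDimensional _) with h0 | h0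
    · exact absurd (Submodule.span_singleton_eq_bot.mp h0) hv
    · exact Submodule.mem_span_singleton.mp (h0 ▸ Submodule.mem_top)
  · push Not at hv
    exact rank_le_one_iff.mpr ⟨0, fun w => ⟨0, by rw [hv w, smul_zero]⟩⟩

variable {n : ℕ} {A : Type} [NonUnitalCStarAlgebra A]

theorem IsIrreducibleRep.comp_inr {H : Type*} [NormedAddCommGroup H] [InnerProductSpace ℂ H]
    [CompleteSpace H] {π : Unitization ℂ A →⋆ₙₐ[ℂ] (H →L[ℂ] H)} (hπ : IsIrreducibleRep π)
    (h : ∃ a : A, π a ≠ 0) :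
    IsIrreducibleRep (π.comp (Unitization.inrNonUnitalStarAlgHom ℂ A)) := by
  refine ⟨h, fun S hS hinv => hπ.2 S hS fun x v hv => ?_⟩
  induction x using Unitization.ind with
  | inl_add_inr z a =>
    have h1 : (Unitization.inl z : Unitization ℂ A) = z • 1 := by
      rw [← Algebra.algebraMap_eq_smul_one]; rfl
    rw [map_add, h1, map_smul, hπ.map_one]
    exact S.add_mem (S.smul_mem z hv) (hinv a v hv)

theorem IsSubhomogeneous.unitization_s8 (hn : 1 ≤ n) (hA : IsSubhomogeneous n A) :
    IsSubhomogeneous n (Unitization ℂ A) := by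
  intro H _ _ _ π hπ
  by_cases h : ∃ a : A, π a ≠ 0
  · exact hA H _ (hπ.comp_inr h)
  · push Not at h
    refine (rank_le_one_of_forall_isClosed fun S hS => hπ.2 S hS fun x v hv => ?_).trans
      (by exact_mod_cast hn)
    induction x using Unitization.ind with
    | inl_add_inr z a =>
      have h1 : (Unitization.inl z : Unitization ℂ A) = z • 1 := by
        rw [← Algebra.algebraMap_eq_smul_one]; rfl
      rw [map_add, h1, map_smul, hπ.map_one, h, add_zero]
      exact S.smul_mem z hv

theorem IsSubhomogeneous.capelli_eq_zero {B : Type} [CStarAlgebra B] (hB : IsSubhomogeneous n B)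
    {m : ℕ} (hm : n * n < m) (a b x : Fin m → B) : capelli a b x = 0 := by
  by_contra h
  obtain ⟨H, _, _, _, π, hπ, hne⟩ := exists_isIrreducibleRep_apply_ne_zero h
  refine hne ?_
  change hπ.toStarAlgHom _ = 0
  rw [map_capelli]
  exact capelli_eq_zero_of_rank_le (hB H π hπ) hm _ _ _

/-- The von Neumann algebra generated by a representation of an `n`-subhomogeneous C*-algebra is
`n`-subhomogeneous. -/
theorem IsSubhomogeneous.centralizer_centralizer (hn : 1 ≤ n) (hA : IsSubhomogeneous n A)
    {H : Type*} [NormedAddCommGroup H] [InnerProductSpace ℂ H] [CompleteSpace H]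
    (π : A →⋆ₙₐ[ℂ] (H →L[ℂ] H)) :
    IsSubhomogeneous n (StarSubalgebra.centralizer ℂ
      (Set.centralizer (Set.range (π : A → (H →L[ℂ] H)))) : StarSubalgebra ℂ (H →L[ℂ] H)) := by
  have hm : n * n < (n + 1) * (n + 1) := by nlinarith
  let π' := Unitization.starLift π
  have hmem (T : StarSubalgebra.centralizer ℂ
      (Set.centralizer (Set.range (π : A → (H →L[ℂ] H))))) :
      ((T : H →L[ℂ] H) : H → H) ∈ closure ((fun s : H →L[ℂ] H => (s : H → H)) ''
        (π'.range : Set (H →L[ℂ] H))) := by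
    refine mem_closure_of_mem_centralizer_centralizer _ fun R hR => ?_
    refine ((StarSubalgebra.mem_centralizer_iff ℂ).mp T.2 R ?_).1
    rintro _ ⟨a, rfl⟩
    exact hR _ ⟨a, by simp [π']⟩
  have hM (a b x : Fin ((n + 1) * (n + 1)) → StarSubalgebra.centralizer ℂ
      (Set.centralizer (Set.range (π : A → (H →L[ℂ] H))))) : capelli a b x = 0 := by
    apply Subtype.val_injective
    change StarSubalgebra.subtype _ _ = 0
    rw [map_capelli]
    refine capelli_eq_zero_of_mem_closure (S := (π'.range : Set (H →L[ℂ] H)))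
      (fun a b x ha hb hx => ?_) (fun k => hmem (a k)) (fun k => hmem (b k)) fun k => hmem (x k)
    choose a' ha' using ha
    choose b' hb' using hb
    choose x' hx' using hx
    obtain rfl : π' ∘ a' = a := funext ha'
    obtain rfl : π' ∘ b' = b := funext hb'
    obtain rfl : π' ∘ x' = x := funext hx'
    rw [← map_capelli, (hA.unitization_s8 hn).capelli_eq_zero hm, map_zero]
  intro K _ _ _ ρ hρ
  refine rank_le_of_capelli_eq_zero fun a b x => ?_
  refine capelli_eq_zero_of_mem_closure (fun a b x ha hb hx => ?_)
    (fun k => hρ.mem_closure_range (a k)) (fun k => hρ.mem_closure_range (b k))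
    fun k => hρ.mem_closure_range (x k)
  choose a' ha' using ha
  choose b' hb' using hb
  choose x' hx' using hx
  obtain rfl : hρ.toStarAlgHom ∘ a' = a := funext ha'
  obtain rfl : hρ.toStarAlgHom ∘ b' = b := funext hb'
  obtain rfl : hρ.toStarAlgHom ∘ x' = x := funext hx'
  rw [← map_capelli, hM, map_zero]

/-- A representation of a C*-algebra on some Hilbert space. -/
structure HilbertRep (A : Type) [NonUnitalCStarAlgebra A] where
  /-- The Hilbert space of the representation. -/
  space : Type
  [normed : NormedAddCommGroup space]
  [inner : InnerProductSpace ℂ space]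
  [complete : CompleteSpace space]
  /-- The action of the algebra. -/
  rep : A →⋆ₙₐ[ℂ] (space →L[ℂ] space)

attribute [instance] HilbertRep.normed HilbertRep.inner HilbertRep.complete

theorem exists_hilbertRep_apply_ne_zero {a : A} (ha : a ≠ 0) :
    ∃ π : HilbertRep A, π.rep a ≠ 0 := by
  have : (a : Unitization ℂ A) ≠ 0 := fun h => ha (Unitization.inr_injective h)
  obtain ⟨H, _, _, _, π, -, hne⟩ := exists_isIrreducibleRep_apply_ne_zero this
  exact ⟨⟨H, π.comp (Unitization.inrNonUnitalStarAlgHom ℂ A)⟩, hne⟩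

/-- Every representation of a C*-algebra is contained in a faithful one. -/
theorem exists_injective_rep_intertwining {K : Type} [NormedAddCommGroup K]
    [InnerProductSpace ℂ K] [CompleteSpace K] (σ : A →⋆ₙₐ[ℂ] (K →L[ℂ] K)) :
    ∃ (H : Type) (_ : NormedAddCommGroup H) (_ : InnerProductSpace ℂ H) (_ : CompleteSpace H)
      (π : A →⋆ₙₐ[ℂ] (H →L[ℂ] H)) (V : K →ₗᵢ[ℂ] H),
      Function.Injective π ∧ ∀ a v, π a (V v) = V (σ a v) := by
  classical
  have : Nonempty (HilbertRep A) := ⟨⟨K, σ⟩⟩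
  choose! r hr using fun a : A => exists_hilbertRep_apply_ne_zero (a := a)
  let F : Option A → HilbertRep A := fun o => o.elim ⟨K, σ⟩ r
  let π := directSumRep fun o => (F o).rep
  let V : K →ₗᵢ[ℂ] lp (fun o => (F o).space) 2 :=
    { lp.lsingle (𝕜 := ℂ) (E := fun o => (F o).space) 2 none with
      norm_map' := fun v => lp.norm_single (E := fun o => (F o).space) (by simp) none v }
  refine ⟨lp (fun o => (F o).space) 2, inferInstance, inferInstance, inferInstance, π, V, ?_,
    fun a v => directSumRep_single (fun o => (F o).rep) a none v⟩
  rw [injective_iff_map_eq_zero]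
  intro a ha
  by_contra hne
  refine hr a hne ?_
  ext v
  have h1 := directSumRep_single (fun o => (F o).rep) a (some a) v
  have h2 := congrArg (fun f : lp (fun o => (F o).space) 2 => f (some a)) h1
  simp only [π] at ha
  simp only [ha, lp.single_apply_self] at h2
  exact h2.symm

end Subhomogeneous

section Compression

variable {A : Type*} [NonUnitalNonAssocSemiring A] [DistribMulAction ℂ A] [Star A]
  {H K : Type*} [NormedAddCommGroup H] [InnerProductSpace ℂ H] [CompleteSpace H]
  [NormedAddCommGroup K] [InnerProductSpace ℂ K] [CompleteSpace K]

theorem adjoint_comp_eq_comp_adjoint_of_intertwining {π : A →⋆ₙₐ[ℂ] (H →L[ℂ] H)}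
    {σ : A →⋆ₙₐ[ℂ] (K →L[ℂ] K)} {V : K →L[ℂ] H} (hV : ∀ a v, π a (V v) = V (σ a v)) (a : A)
    (u : H) :
    ContinuousLinearMap.adjoint V (π a u) = σ a (ContinuousLinearMap.adjoint V u) := by
  refine ext_inner_right ℂ fun v => ?_
  rw [ContinuousLinearMap.adjoint_inner_left, ← ContinuousLinearMap.adjoint_inner_right,
    ← ContinuousLinearMap.star_eq_adjoint, ← map_star, ← ContinuousLinearMap.adjoint_inner_right,
    ← ContinuousLinearMap.star_eq_adjoint (σ a), ← map_star,
    ContinuousLinearMap.adjoint_inner_left, hV]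

theorem exists_extension_of_intertwining {π : A →⋆ₙₐ[ℂ] (H →L[ℂ] H)}
    {σ : A →⋆ₙₐ[ℂ] (K →L[ℂ] K)} {V : K →ₗᵢ[ℂ] H} (hV : ∀ a v, π a (V v) = V (σ a v)) :
    ∃ φ : (StarSubalgebra.centralizer ℂ
        (Set.centralizer (Set.range (π : A → (H →L[ℂ] H)))) : StarSubalgebra ℂ (H →L[ℂ] H)) →⋆ₙₐ[ℂ]
          (K →L[ℂ] K),
      ∀ T v, V (φ T v) = (T : H →L[ℂ] H) (V v) := by
  let W : K →L[ℂ] H := V.toContinuousLinearMap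
  let W' := ContinuousLinearMap.adjoint W
  have hW' (v : K) : W' (W v) = v := by
    refine ext_inner_right ℂ fun w => ?_
    rw [ContinuousLinearMap.adjoint_inner_left]
    exact V.inner_map_map v w
  have hP : W ∘L W' ∈ Set.centralizer (Set.range (π : A → (H →L[ℂ] H))) := by
    rintro _ ⟨a, rfl⟩
    ext u
    change π a (V (W' u)) = V (W' (π a u))
    rw [hV, adjoint_comp_eq_comp_adjoint_of_intertwining (V := W) hV]
  have key (T : (StarSubalgebra.centralizer ℂ
      (Set.centralizer (Set.range (π : A → (H →L[ℂ] H)))) : StarSubalgebra ℂ (H →L[ℂ] H))) (v : K) :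
      W (W' ((T : H →L[ℂ] H) (W v))) = (T : H →L[ℂ] H) (W v) := by
    have h := DFunLike.congr_fun (((StarSubalgebra.mem_centralizer_iff ℂ).mp T.2 _ hP).1) (W v)
    change W (W' ((T : H →L[ℂ] H) (W v))) = (T : H →L[ℂ] H) (W (W' (W v))) at h
    rwa [hW'] at h
  refine ⟨{
    toFun := fun T => W' ∘L (T : H →L[ℂ] H) ∘L W
    map_smul' := fun c T => by ext v; simp
    map_zero' := by ext v; simp
    map_add' := fun S T => by ext v; simp
    map_mul' := fun S T => by
      ext v
      change W' ((S : H →L[ℂ] H) ((T : H →L[ℂ] H) (W v))) =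
        W' ((S : H →L[ℂ] H) (W (W' ((T : H →L[ℂ] H) (W v)))))
      rw [key]
    map_star' := fun T => by
      simp only [ContinuousLinearMap.star_eq_adjoint, ContinuousLinearMap.adjoint_comp,
        StarMemClass.coe_star, W', ContinuousLinearMap.adjoint_adjoint]
      rfl }, key⟩

end Compression

/-- A C*-algebra `A` is `n`-subhomogeneous if and only if its enveloping
von Neumann algebra (bidual) `A**` is `n`-subhomogeneous as a C*-algebra.  The bidual is
realised spatially: for every faithful (injective) representation `π` of `A` on a Hilbert
space, the weak closure of `π(A)`, i.e. the double commutant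
`(π(A))'' = StarSubalgebra.centralizer ℂ (centralizer (range π))`, is a quotient of
`A**`; for the universal representation it is `A**` itself. -/
theorem stmt8 (n : ℕ) (hn : 1 ≤ n) (A : Type) [NonUnitalCStarAlgebra A] :
    IsSubhomogeneous n A ↔
      ∀ (H : Type) [NormedAddCommGroup H] [InnerProductSpace ℂ H] [CompleteSpace H]
        (π : A →⋆ₙₐ[ℂ] (H →L[ℂ] H)), Function.Injective π →
          IsSubhomogeneous n
            (StarSubalgebra.centralizer ℂ
              (Set.centralizer (Set.range (π : A → (H →L[ℂ] H)))) :
                StarSubalgebra ℂ (H →L[ℂ] H)) := by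
  refine ⟨fun hA H _ _ _ π _ => hA.centralizer_centralizer hn π, fun h K _ _ _ σ hσ => ?_⟩
  obtain ⟨H, _, _, _, π, V, hπ, hV⟩ := exists_injective_rep_intertwining σ
  obtain ⟨φ, hφ⟩ := exists_extension_of_intertwining hV
  have hmem (a : A) : π a ∈ StarSubalgebra.centralizer ℂ
      (Set.centralizer (Set.range (π : A → (H →L[ℂ] H)))) := by
    refine (StarSubalgebra.mem_centralizer_iff ℂ).mpr fun R hR => ⟨(hR _ ⟨a, rfl⟩).symm, ?_⟩
    have := congrArg star (hR _ ⟨star a, rfl⟩)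
    rwa [star_mul, star_mul, map_star, star_star] at this
  have hφσ (a : A) : φ ⟨π a, hmem a⟩ = σ a := by
    ext v
    exact V.injective ((hφ _ v).trans (hV a v))
  refine h H π hπ K φ ⟨?_, fun S hS hinv => hσ.2 S hS fun a v hv => ?_⟩
  · obtain ⟨a, ha⟩ := hσ.1
    exact ⟨⟨π a, hmem a⟩, by rwa [hφσ]⟩
  · rw [← hφσ]
    exact hinv _ v hv

end
end
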